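/- Suppose β₁^m < β = β₂^m (so λ_m(A) > 0). Then the conclusion for the intermediate parameter regime holds without modification: there exist a γ-invariant set Θ₀ ⊆ Θ of full m-measure and measurable functions α_u, α_s : Θ₀ → [0,1/2) such that for every θ ∈ Θ₀ there is c_β(θ) > 0 with 𝒜_β(θ) = {r·v(α_u(θ)) : |r| ≤ c_β(θ)}, and the two-point set Ψ_β(θ) = {±c_β(θ)·v(α_u(θ))} satisfies lim_{n→∞} dist(f^n_{β,θ}(v), Ψ_β(γ^n θ)) = 0 for every v ∈ ℝ² ∖ ℝ·v(α_s(θ)). -/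

import Mathlib

open Filter MeasureTheory Metric Set
open scoped Topology

noncomputable section

/-- ℝ² with the Euclidean norm. -/
abbrev R2 : Type := EuclideanSpace ℝ (Fin 2)

/-- Action of a 2×2 real matrix on Euclidean ℝ². -/
def mulVecE (M : Matrix (Fin 2) (Fin 2) ℝ) (v : R2) : R2 :=
  (WithLp.equiv 2 (Fin 2 → ℝ)).symm (M.mulVec ((WithLp.equiv 2 (Fin 2 → ℝ)) v))

/-- Operator norm of a 2×2 real matrix induced by the Euclidean norm on ℝ². -/
def opNorm (M : Matrix (Fin 2) (Fin 2) ℝ) : ℝ :=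
  ‖(Matrix.toEuclideanCLM (𝕜 := ℝ) M : R2 →L[ℝ] R2)‖

/-- The cocycle `A_n(θ) = A(γ^{n-1}θ) ⋯ A(θ)`. -/
def coc {Θ : Type*} (γ : Θ → Θ) (A : Θ → Matrix (Fin 2) (Fin 2) ℝ) :
    ℕ → Θ → Matrix (Fin 2) (Fin 2) ℝ
  | 0, _ => 1
  | n + 1, θ => coc γ A n (γ θ) * A θ

/-- Maximal Lyapunov exponent `λ_max(A) = sup_θ limsup (1/n) log‖A_n(θ)‖`. -/
def lyapMax {Θ : Type*} (γ : Θ → Θ) (A : Θ → Matrix (Fin 2) (Fin 2) ℝ) : ℝ :=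
  ⨆ θ : Θ, Filter.limsup (fun n : ℕ => Real.log (opNorm (coc γ A n θ)) / n) Filter.atTop

/-- The hypotheses on `h`: C² on [0,∞), strictly increasing, strictly concave, bounded,
nonnegative, `h 0 = 0`, `h' 0 = 1`. -/
def GoodH (h : ℝ → ℝ) : Prop :=
  ContDiffOn ℝ 2 h (Set.Ici 0) ∧ StrictMonoOn h (Set.Ici 0) ∧
    StrictConcaveOn ℝ (Set.Ici 0) h ∧ BddAbove (h '' Set.Ici 0) ∧
    (∀ x ∈ Set.Ici (0 : ℝ), 0 ≤ h x) ∧ h 0 = 0 ∧ derivWithin h (Set.Ici 0) 0 = 1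

/-- The scaling condition `sup_{x ≥ 0} h(x) ≤ (sup_θ ‖A(θ)‖)⁻¹`. -/
def Scaled {Θ : Type*} (A : Θ → Matrix (Fin 2) (Fin 2) ℝ) (h : ℝ → ℝ) : Prop :=
  ∀ x ∈ Set.Ici (0 : ℝ), h x ≤ (⨆ θ : Θ, opNorm (A θ))⁻¹

open scoped Classical in
/-- The fibre maps `f_{β,θ}(v) = h(β‖v‖)·A(θ)·v/‖v‖`, `f_{β,θ}(0) = 0`. -/
def fibMap {Θ : Type*} (A : Θ → Matrix (Fin 2) (Fin 2) ℝ) (h : ℝ → ℝ) (β : ℝ)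
    (θ : Θ) (v : R2) : R2 :=
  if v = 0 then 0 else (h (β * ‖v‖) / ‖v‖) • mulVecE (A θ) v

/-- The skew product `f_β(θ,v) = (γθ, f_{β,θ}(v))`. -/
def skewProd {Θ : Type*} (γ : Θ → Θ) (A : Θ → Matrix (Fin 2) (Fin 2) ℝ) (h : ℝ → ℝ)
    (β : ℝ) : Θ × R2 → Θ × R2 :=
  fun p => (γ p.1, fibMap A h β p.1 p.2)

/-- The global attractor `𝒜_β = ⋂_{n∈ℕ} f_β^n(Θ × B̄₁(0))`. -/
def globalAttractor {Θ : Type*} (γ : Θ → Θ) (A : Θ → Matrix (Fin 2) (Fin 2) ℝ)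
    (h : ℝ → ℝ) (β : ℝ) : Set (Θ × R2) :=
  ⋂ n : ℕ, (skewProd γ A h β)^[n] '' (Set.univ ×ˢ Metric.closedBall (0 : R2) 1)

/-- The fibre `𝒜_β(θ) = {x : (θ,x) ∈ 𝒜_β}` of the global attractor. -/
def attractorFib {Θ : Type*} (γ : Θ → Θ) (A : Θ → Matrix (Fin 2) (Fin 2) ℝ)
    (h : ℝ → ℝ) (β : ℝ) (θ : Θ) : Set R2 :=
  {x : R2 | (θ, x) ∈ globalAttractor γ A h β}

/-- `v(α) = (cos 2πα, sin 2πα)ᵗ`. -/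
def vFull (α : ℝ) : R2 :=
  (WithLp.equiv 2 (Fin 2 → ℝ)).symm ![Real.cos (2 * Real.pi * α), Real.sin (2 * Real.pi * α)]

/-- `(cos πα, sin πα)ᵗ`, representing the projective point `α ∈ 𝕋 ≅ ℝP¹`. -/
def vHalf (α : ℝ) : R2 :=
  (WithLp.equiv 2 (Fin 2 → ℝ)).symm ![Real.cos (Real.pi * α), Real.sin (Real.pi * α)]

/-- The projective angle coordinate `p(w) = (1/π)·arg(w) mod 1 ∈ [0,1)` of a nonzero
vector `w ∈ ℝ²`; for `w ≠ 0` this equals `(1/π)·arctan(w₂/w₁) mod 1`. -/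
def projAngle (w : R2) : ℝ :=
  Int.fract (Complex.arg (Complex.ofReal (w 0) + Complex.ofReal (w 1) * Complex.I) / Real.pi)

/-- The projective action `g(θ,α) = (γθ, g_θ(α))` of the cocycle on `Θ × 𝕋`,
where `𝕋` is modelled by the fundamental domain `[0,1) ⊆ ℝ`. -/
def gMap {Θ : Type*} (γ : Θ → Θ) (A : Θ → Matrix (Fin 2) (Fin 2) ℝ) :
    Θ × ℝ → Θ × ℝ :=
  fun p => (γ p.1, projAngle (mulVecE (A p.1) (vHalf p.2)))

/-- `Ω(θ,α) = ‖A(θ)(cos πα, sin πα)ᵗ‖`. -/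
def Omega {Θ : Type*} (A : Θ → Matrix (Fin 2) (Fin 2) ℝ) (p : Θ × ℝ) : ℝ :=
  ‖mulVecE (A p.1) (vHalf p.2)‖

/-- The fibre maps `F_{β,θ,α}(r) = h(βr)·Ω(θ,α)` of the double skew product. -/
def dsFib {Θ : Type*} (A : Θ → Matrix (Fin 2) (Fin 2) ℝ) (h : ℝ → ℝ) (β : ℝ)
    (p : Θ × ℝ) (r : ℝ) : ℝ :=
  h (β * r) * Omega A p

/-- The double skew product `F_β(θ,α,r) = (g(θ,α), h(βr)·Ω(θ,α))` on `Θ × 𝕋 × [0,∞)`. -/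
def dsMap {Θ : Type*} (γ : Θ → Θ) (A : Θ → Matrix (Fin 2) (Fin 2) ℝ) (h : ℝ → ℝ)
    (β : ℝ) : Θ × ℝ × ℝ → Θ × ℝ × ℝ :=
  fun p => ((gMap γ A (p.1, p.2.1)).1, (gMap γ A (p.1, p.2.1)).2, dsFib A h β (p.1, p.2.1) p.2.2)

/-- `Ω_n(θ,α) = ∏_{i=0}^{n-1} Ω(g^i(θ,α))`. -/
def OmegaProd {Θ : Type*} (γ : Θ → Θ) (A : Θ → Matrix (Fin 2) (Fin 2) ℝ) (n : ℕ)
    (p : Θ × ℝ) : ℝ :=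
  ∏ i ∈ Finset.range n, Omega A ((gMap γ A)^[i] p)

/-- `Γ(a,b) = inf_{a ≤ x ≤ 1} inf_{0 < q ≤ b} h(qx)/(q·h(x))`. -/
def GammaH (h : ℝ → ℝ) (a b : ℝ) : ℝ :=
  sInf {y : ℝ | ∃ x ∈ Set.Icc a 1, ∃ q ∈ Set.Ioc (0 : ℝ) b, y = h (q * x) / (q * h x)}

/-- The inverse `g⁻¹(θ,α) = (γ⁻¹θ, projective angle of A(γ⁻¹θ)⁻¹·v(α))` of the
projective action. -/
def gInv {Θ : Type*} (γinv : Θ → Θ) (A : Θ → Matrix (Fin 2) (Fin 2) ℝ) :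
    Θ × ℝ → Θ × ℝ :=
  fun p => (γinv p.1, projAngle (mulVecE (A (γinv p.1))⁻¹ (vHalf p.2)))

/-- `F^n_{β,g^{-n}(θ,α)}(1)`, the pullback iterate defining the upper bounding graph. -/
def pullback1 {Θ : Type*} (γ : Θ → Θ) (γinv : Θ → Θ) (A : Θ → Matrix (Fin 2) (Fin 2) ℝ)
    (h : ℝ → ℝ) (β : ℝ) (n : ℕ) (p : Θ × ℝ) : ℝ :=
  ((dsMap γ A h β)^[n] (((gInv γinv A)^[n] p).1, ((gInv γinv A)^[n] p).2, 1)).2.2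

section Ergodic

variable {Θ : Type*} {T : Θ → Θ}

theorem abs_birkhoffSum_le {f : Θ → ℝ} {L : ℝ} (hL : ∀ θ, |f θ| ≤ L) (n : ℕ) (θ : Θ) :
    |birkhoffSum T f n θ| ≤ n * L := by
  unfold birkhoffSum
  calc _ ≤ ∑ k ∈ Finset.range n, |f (T^[k] θ)| := Finset.abs_sum_le_sum_abs _ _
    _ ≤ ∑ k ∈ Finset.range n, L := Finset.sum_le_sum fun i _ => hL _
    _ = n * L := by simp

/-- Outside the return-time set `B`, a subadditive sequence can be cut into blocks on which it is
nonpositive. -/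
theorem subadditive_le_birkhoffSum_indicator {a : ℕ → Θ → ℝ} {L : ℝ} (hL0 : 0 ≤ L)
    (hL : ∀ n θ, |a n θ| ≤ n * L)
    (hsub : ∀ n k θ, a (n + k) θ ≤ a n θ + a k (T^[n] θ)) {N : ℕ} {B : Set Θ}
    (hB : ∀ θ, θ ∉ B → ∃ n, 1 ≤ n ∧ n ≤ N ∧ a n θ ≤ 0) (K : ℕ) (θ : Θ) :
    a K θ ≤ L * birkhoffSum T (B.indicator fun _ => (1 : ℝ)) K θ + N * L := by
  have hnn : ∀ n θ, 0 ≤ birkhoffSum T (B.indicator fun _ => (1 : ℝ)) n θ := fun n θ =>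
    Finset.sum_nonneg fun i _ => indicator_nonneg (fun _ _ => zero_le_one) _
  induction K using Nat.strong_induction_on generalizing θ with
  | _ K ih =>
    rcases le_or_gt K N with hK | hK
    · have h1 := (abs_le.1 (hL K θ)).2
      have h2 : (K : ℝ) * L ≤ N * L := by gcongr
      have h3 := mul_nonneg hL0 (hnn K θ)
      linarith
    · by_cases hθ : θ ∈ B
      · obtain ⟨k, rfl⟩ : ∃ k, K = 1 + k := ⟨K - 1, by omega⟩
        have h1 := (abs_le.1 (hL 1 θ)).2
        have h2 := ih k (by omega) (T^[1] θ)
        have h3 := hsub 1 k θ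
        rw [birkhoffSum_add, birkhoffSum_one, indicator_of_mem hθ]
        push_cast at h1
        linarith
      · obtain ⟨n, hn1, hnN, hn⟩ := hB θ hθ
        obtain ⟨k, rfl⟩ : ∃ k, K = n + k := ⟨K - n, by omega⟩
        have h2 := ih k (by omega) (T^[n] θ)
        have h3 := hsub n k θ
        have h4 := mul_nonneg hL0 (hnn n θ)
        rw [birkhoffSum_add]
        linarith

theorem sum_blocks_le_birkhoffSum {a : ℕ → Θ → ℝ}
    (hsub : ∀ n k θ, a (n + k) θ ≤ a n θ + a k (T^[n] θ)) (k n : ℕ) (θ : Θ) :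
    ∑ i ∈ Finset.range k, a (k + n - i) (T^[i] θ) ≤
      birkhoffSum T (a k) n θ + ∑ i ∈ Finset.range k, a (k - i) (T^[i] (T^[n] θ)) := by
  induction n generalizing θ with
  | zero => simp
  | succ n ih =>
    have h1 := ih (T θ)
    have h2 := hsub k (n + 1) θ
    have h3 : ∑ i ∈ Finset.range k, a (k + (n + 1) - i) (T^[i] θ) + a (n + 1) (T^[k] θ) =
        ∑ i ∈ Finset.range k, a (k + n - i) (T^[i] (T θ)) + a (k + (n + 1)) θ := by
      have e1 := Finset.sum_range_succ (fun i => a (k + (n + 1) - i) (T^[i] θ)) k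
      have e2 := Finset.sum_range_succ' (fun i => a (k + (n + 1) - i) (T^[i] θ)) k
      have e3 : ∀ i ∈ Finset.range k, a (k + (n + 1) - (i + 1)) (T^[i + 1] θ) =
          a (k + n - i) (T^[i] (T θ)) := fun i _ => by
        rw [Function.iterate_succ_apply]
        congr 1
        omega
      rw [Finset.sum_congr rfl e3] at e2
      have e4 : k + (n + 1) - k = n + 1 := by omega
      simp only [e4, Nat.sub_zero, Function.iterate_zero, id] at e1 e2
      linarith
    rw [birkhoffSum_succ', Function.iterate_succ_apply]
    linarith

variable [MeasurableSpace Θ] {m : Measure Θ}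

theorem integral_comp_measurePreserving (hT : MeasurePreserving T m m) {f : Θ → ℝ}
    (hf : Measurable f) : ∫ θ, f (T θ) ∂m = ∫ θ, f θ ∂m := by
  conv_rhs => rw [← hT.map_eq]
  rw [integral_map hT.measurable.aemeasurable hf.aestronglyMeasurable]

theorem measurable_birkhoffSum (hT : Measurable T) {f : Θ → ℝ} (hf : Measurable f) (n : ℕ) :
    Measurable (birkhoffSum T f n) := by
  unfold birkhoffSum
  exact Finset.measurable_fun_sum _ fun i _ => hf.comp (hT.iterate i)

theorem integrable_of_abs_le [IsFiniteMeasure m] {f : Θ → ℝ} (hf : Measurable f) {L : ℝ}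
    (hL : ∀ θ, |f θ| ≤ L) : Integrable f m :=
  Integrable.of_bound hf.aestronglyMeasurable L (Eventually.of_forall hL)

theorem integral_birkhoffSum [IsFiniteMeasure m] (hT : MeasurePreserving T m m) {f : Θ → ℝ}
    (hf : Measurable f) {L : ℝ} (hL : ∀ θ, |f θ| ≤ L) (n : ℕ) :
    ∫ θ, birkhoffSum T f n θ ∂m = n * ∫ θ, f θ ∂m := by
  unfold birkhoffSum
  rw [integral_finsetSum]
  · have h : ∀ i ∈ Finset.range n, ∫ θ, f (T^[i] θ) ∂m = ∫ θ, f θ ∂m := fun i _ =>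
      integral_comp_measurePreserving (hT.iterate i) hf
    rw [Finset.sum_congr rfl h]
    simp
  · exact fun i _ => integrable_of_abs_le (hf.comp (hT.measurable.iterate i)) fun θ => hL _

theorem subadditive_limit_nonpos [IsProbabilityMeasure m] (hT : MeasurePreserving T m m)
    {a : ℕ → Θ → ℝ} (ham : ∀ n, Measurable (a n)) {L : ℝ} (hL : ∀ n θ, |a n θ| ≤ n * L)
    (hsub : ∀ n k θ, a (n + k) θ ≤ a n θ + a k (T^[n] θ))
    (hex : ∀ᵐ θ ∂m, ∃ n, 1 ≤ n ∧ a n θ ≤ 0) {lam : ℝ}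
    (hlim : Tendsto (fun n : ℕ => (∫ θ, a n θ ∂m) / n) atTop (𝓝 lam)) : lam ≤ 0 := by
  have hL0 : 0 ≤ L := by
    obtain ⟨θ⟩ : Nonempty Θ := m.nonempty_of_neZero
    simpa using (abs_nonneg _).trans (hL 1 θ)
  let B : ℕ → Set Θ := fun N => {θ | ∀ n, 1 ≤ n → n ≤ N → 0 < a n θ}
  have hBm : ∀ N, MeasurableSet (B N) := fun N => by
    have : B N = ⋂ n, ⋂ (_ : 1 ≤ n), ⋂ (_ : n ≤ N), {θ | 0 < a n θ} := by
      ext θ; simp [B]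
    rw [this]
    exact MeasurableSet.iInter fun n => MeasurableSet.iInter fun _ => MeasurableSet.iInter fun _ =>
      measurableSet_lt measurable_const (ham n)
  have hBanti : Antitone B := fun N M hNM θ hθ n h1 h2 => hθ n h1 (h2.trans hNM)
  have hB0 : Tendsto (fun N => m.real (B N)) atTop (𝓝 0) := by
    have h1 := tendsto_measure_iInter_atTop (μ := m) (fun N => (hBm N).nullMeasurableSet) hBanti
      ⟨0, measure_ne_top _ _⟩
    have h2 : m (⋂ N, B N) = 0 := by
      refine measure_mono_null (fun θ hθ => ?_) hex
      simp only [mem_iInter] at hθ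
      rintro ⟨n, hn, hn'⟩
      exact absurd (hθ n n hn le_rfl) (not_lt.2 hn')
    rw [h2] at h1
    exact (ENNReal.tendsto_toReal ENNReal.zero_ne_top).comp h1
  have hN : ∀ N, lam ≤ L * m.real (B N) := fun N => by
    have hind : Measurable ((B N).indicator fun _ => (1 : ℝ)) :=
      measurable_const.indicator (hBm N)
    have hindle : ∀ θ, |(B N).indicator (fun _ => (1 : ℝ)) θ| ≤ 1 := fun θ => by
      by_cases h : θ ∈ B N <;> simp [h]
    have hK : ∀ K : ℕ, ∫ θ, a K θ ∂m ≤ K * (L * m.real (B N)) + N * L := fun K => by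
      have hi : Integrable (fun θ => L * birkhoffSum T ((B N).indicator fun _ => (1 : ℝ)) K θ) m :=
        (integrable_of_abs_le (measurable_birkhoffSum hT.measurable hind K)
          (abs_birkhoffSum_le hindle K)).const_mul L
      calc ∫ θ, a K θ ∂m
          ≤ ∫ θ, (L * birkhoffSum T ((B N).indicator fun _ => (1 : ℝ)) K θ + N * L) ∂m := by
            refine integral_mono (integrable_of_abs_le (ham K) (hL K))
              (hi.add (integrable_const _)) fun θ => ?_
            refine subadditive_le_birkhoffSum_indicator hL0 hL hsub (fun θ hθ => ?_) K θ
            simp only [B, mem_ofPred_eq, not_forall, not_lt] at hθ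
            obtain ⟨n, h1, h2, h3⟩ := hθ
            exact ⟨n, h1, h2, h3⟩
        _ = K * (L * m.real (B N)) + N * L := by
            rw [integral_add hi (integrable_const _), integral_const_mul,
              integral_birkhoffSum hT hind hindle, integral_indicator (hBm N)]
            simp
            ring
    have h0 : Tendsto (fun K : ℕ => L * m.real (B N) + N * L / K) atTop
        (𝓝 (L * m.real (B N) + 0)) :=
      tendsto_const_nhds.add (tendsto_const_div_atTop_nhds_zero_nat _)
    rw [add_zero] at h0
    refine le_of_tendsto_of_tendsto hlim h0 ?_
    filter_upwards [eventually_gt_atTop 0] with K hK0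
    have : (0 : ℝ) < K := by exact_mod_cast hK0
    rw [div_le_iff₀ this]
    have h3 := hK K
    field_simp
    linarith
  have := hB0.const_mul L
  rw [mul_zero] at this
  exact ge_of_tendsto' this hN

/-- A measurable set of positive measure is visited from almost every point. -/
theorem ae_exists_iterate_mem (hT : Ergodic T m) [IsFiniteMeasure m] {G : Set Θ}
    (hG : MeasurableSet G) (hG0 : m G ≠ 0) : ∀ᵐ θ ∂m, ∃ k, T^[k] θ ∈ G := by
  let V : Set Θ := ⋃ k, T^[k] ⁻¹' G
  have hV : MeasurableSet V :=
    MeasurableSet.iUnion fun k => hT.measurable.iterate k hG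
  have hsub : T ⁻¹' V ⊆ V := by
    intro θ hθ
    simp only [V, mem_preimage, mem_iUnion] at hθ ⊢
    obtain ⟨k, hk⟩ := hθ
    exact ⟨k + 1, hk⟩
  rcases hT.ae_empty_or_univ_of_preimage_ae_le hV.nullMeasurableSet
    (Eventually.of_forall hsub) with h | h
  · exfalso
    have h1 : m V = 0 := by rw [measure_congr h]; simp
    exact hG0 (measure_mono_null (fun θ hθ => mem_iUnion.2 ⟨0, hθ⟩) h1)
  · filter_upwards [h] with θ hθ
    have : θ ∈ V := by
      rw [show (θ ∈ V) = (V θ) from rfl, hθ]; trivial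
    simpa [V] using this

theorem ae_frequently_iterate_mem (hT : Ergodic T m) [IsFiniteMeasure m] {G : Set Θ}
    (hG : MeasurableSet G) (hG0 : m G ≠ 0) : ∀ᵐ θ ∂m, ∃ᶠ k in atTop, T^[k] θ ∈ G := by
  have h1 := hT.toMeasurePreserving.quasiMeasurePreserving
  have h2 : ∀ n : ℕ, ∀ᵐ θ ∂m, ∃ k, T^[k] (T^[n] θ) ∈ G := fun n =>
    (h1.iterate n).ae (ae_exists_iterate_mem hT hG hG0)
  filter_upwards [ae_all_iff.2 h2] with θ hθ
  rw [frequently_atTop]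
  intro n
  obtain ⟨k, hk⟩ := hθ n
  exact ⟨k + n, by omega, by rwa [Function.iterate_add_apply]⟩

theorem subadditive_ae_eventually_ge [IsProbabilityMeasure m] (hT : Ergodic T m)
    {a : ℕ → Θ → ℝ} (ham : ∀ n, Measurable (a n)) {L : ℝ} (hL : ∀ n θ, |a n θ| ≤ n * L)
    (hsub : ∀ n k θ, a (n + k) θ ≤ a n θ + a k (T^[n] θ))
    (hshift : ∀ n θ, a n (T θ) ≤ a (n + 1) θ + L) {lam : ℝ}
    (hlim : Tendsto (fun n : ℕ => (∫ θ, a n θ ∂m) / n) atTop (𝓝 lam)) {c : ℝ} (hc : c < lam) :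
    ∀ᵐ θ ∂m, ∀ᶠ n : ℕ in atTop, n * c ≤ a n θ := by
  obtain ⟨c₁, hc1, hc2⟩ := exists_between hc
  let G : Set Θ := {θ | ∀ n : ℕ, 1 ≤ n → n * c₁ < a n θ}
  have hGm : MeasurableSet G := by
    have : G = ⋂ n : ℕ, ⋂ (_ : 1 ≤ n), {θ | n * c₁ < a n θ} := by ext θ; simp [G]
    rw [this]
    exact MeasurableSet.iInter fun n => MeasurableSet.iInter fun _ =>
      measurableSet_lt measurable_const (ham n)
  have hG0 : m G ≠ 0 := by
    intro h0
    have hex : ∀ᵐ θ ∂m, ∃ n : ℕ, 1 ≤ n ∧ a n θ - n * c₁ ≤ 0 := by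
      filter_upwards [compl_mem_ae_iff.2 h0] with θ hθ
      simp only [G, mem_compl_iff, mem_ofPred_eq, not_forall, not_lt] at hθ
      obtain ⟨n, hn, hn'⟩ := hθ
      exact ⟨n, hn, by linarith⟩
    have hlim' : Tendsto (fun n : ℕ => (∫ θ, (a n θ - n * c₁) ∂m) / n) atTop (𝓝 (lam - c₁)) := by
      refine (hlim.sub_const c₁).congr' ?_
      filter_upwards [eventually_gt_atTop 0] with n hn
      have : (0 : ℝ) < n := by exact_mod_cast hn
      rw [integral_sub (integrable_of_abs_le (ham n) (hL n)) (integrable_const _)]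
      simp
      field_simp
    have := subadditive_limit_nonpos (a := fun n θ => a n θ - n * c₁) (L := L + |c₁|)
      hT.toMeasurePreserving
      (fun n => (ham n).sub_const _) (fun n θ => ?_) (fun n k θ => ?_) hex hlim'
    · linarith
    · calc |a n θ - n * c₁| ≤ |a n θ| + |n * c₁| := abs_sub _ _
        _ ≤ n * L + n * |c₁| := by
          rw [abs_mul, Nat.abs_cast]; gcongr; exact hL n θ
        _ = _ := by ring
    · have := hsub n k θ
      push_cast
      linarith
  filter_upwards [ae_exists_iterate_mem hT hGm hG0] with θ hθ
  obtain ⟨k, hk⟩ := hθ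
  have hsh : ∀ k n θ, a n (T^[k] θ) ≤ a (n + k) θ + k * L := by
    intro k
    induction k with
    | zero => intro n θ; simp
    | succ k ih =>
      intro n θ
      have h1 := ih n (T θ)
      have h2 := hshift (n + k) θ
      rw [Function.iterate_succ_apply]
      push_cast
      rw [← add_assoc]
      linarith
  have hev : ∀ᶠ n : ℕ in atTop, k * c₁ + k * L ≤ n * (c₁ - c) :=
    (tendsto_natCast_atTop_atTop.atTop_mul_const (sub_pos.2 hc1)).eventually_ge_atTop _
  filter_upwards [hev, eventually_gt_atTop k] with n hn hnk
  obtain ⟨j, rfl⟩ : ∃ j, n = j + k := ⟨n - k, by omega⟩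
  have h1 := hk j (by omega)
  have h2 := hsh k j θ
  push_cast at hn ⊢
  nlinarith

theorem birkhoffSum_ae_eventually_ge [IsProbabilityMeasure m] (hT : Ergodic T m) {f : Θ → ℝ}
    (hf : Measurable f) {L : ℝ} (hL : ∀ θ, |f θ| ≤ L) {c : ℝ} (hc : c < ∫ θ, f θ ∂m) :
    ∀ᵐ θ ∂m, ∀ᶠ n : ℕ in atTop, n * c ≤ birkhoffSum T f n θ := by
  refine subadditive_ae_eventually_ge hT (measurable_birkhoffSum hT.measurable hf)
    (abs_birkhoffSum_le hL) (fun n k θ => (birkhoffSum_add T f n k θ).le) (fun n θ => ?_)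
    (lam := ∫ θ, f θ ∂m) ?_ hc
  · rw [birkhoffSum_succ']
    have := (abs_le.1 (hL θ)).1
    linarith
  · refine tendsto_const_nhds.congr' ?_
    filter_upwards [eventually_gt_atTop 0] with n hn
    have : (0 : ℝ) < n := by exact_mod_cast hn
    rw [integral_birkhoffSum hT.toMeasurePreserving hf hL]
    field_simp

theorem birkhoffSum_ae_eventually_le [IsProbabilityMeasure m] (hT : Ergodic T m) {f : Θ → ℝ}
    (hf : Measurable f) {L : ℝ} (hL : ∀ θ, |f θ| ≤ L) {c : ℝ} (hc : ∫ θ, f θ ∂m < c) :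
    ∀ᵐ θ ∂m, ∀ᶠ n : ℕ in atTop, birkhoffSum T f n θ ≤ n * c := by
  have h := birkhoffSum_ae_eventually_ge hT hf.neg (L := L) (fun θ => by simpa using hL θ)
    (c := -c) (by simp only [Pi.neg_apply, integral_neg]; linarith)
  filter_upwards [h] with θ hθ
  filter_upwards [hθ] with n hn
  have : birkhoffSum T (-f) n θ = -birkhoffSum T f n θ := by simp [birkhoffSum]
  linarith

theorem subadditive_ae_eventually_le [IsProbabilityMeasure m] (hT : Ergodic T m)
    {a : ℕ → Θ → ℝ} (ham : ∀ n, Measurable (a n)) {L : ℝ} (hL : ∀ n θ, |a n θ| ≤ n * L)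
    (hsub : ∀ n k θ, a (n + k) θ ≤ a n θ + a k (T^[n] θ))
    {lam : ℝ}
    (hlim : Tendsto (fun n : ℕ => (∫ θ, a n θ ∂m) / n) atTop (𝓝 lam)) {c : ℝ} (hc : lam < c) :
    ∀ᵐ θ ∂m, ∀ᶠ n : ℕ in atTop, a n θ ≤ n * c := by
  have hL0 : 0 ≤ L := by
    obtain ⟨θ⟩ : Nonempty Θ := m.nonempty_of_neZero
    simpa using (abs_nonneg _).trans (hL 1 θ)
  obtain ⟨c₁, hc1, hc2⟩ := exists_between hc
  obtain ⟨k, hk, hk0⟩ := ((hlim.eventually_lt_const hc1).and (eventually_gt_atTop 0)).exists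
  have hk0' : (0 : ℝ) < k := by exact_mod_cast hk0
  rw [div_lt_iff₀ hk0'] at hk
  filter_upwards [birkhoffSum_ae_eventually_le hT (ham k) (hL k) hk] with θ hθ
  have hev : ∀ᶠ n : ℕ in atTop, 2 * k * k * L - k * k * c ≤ n * (k * (c - c₁)) :=
    (tendsto_natCast_atTop_atTop.atTop_mul_const
      (mul_pos hk0' (sub_pos.2 hc2))).eventually_ge_atTop _
  obtain ⟨n₀, hn₀⟩ := eventually_atTop.1 (hθ.and hev)
  filter_upwards [eventually_ge_atTop (n₀ + k)] with N hN
  obtain ⟨n, rfl⟩ : ∃ n, N = k + n := ⟨N - k, by omega⟩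
  obtain ⟨h1, h2⟩ := hn₀ n (by omega)
  have h3 := sum_blocks_le_birkhoffSum hsub k n θ
  have h4 : k * a (k + n) θ - k * (k * L) ≤
      ∑ i ∈ Finset.range k, a (k + n - i) (T^[i] θ) := by
    have : ∀ i ∈ Finset.range k, a (k + n) θ - k * L ≤ a (k + n - i) (T^[i] θ) := by
      intro i hi
      have hi' := Finset.mem_range.1 hi
      have h5 := hsub i (k + n - i) θ
      rw [show i + (k + n - i) = k + n by omega] at h5
      have h6 := (abs_le.1 (hL i θ)).2
      have h7 : (i : ℝ) * L ≤ k * L := by gcongr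
      linarith
    have := Finset.sum_le_sum this
    simp only [Finset.sum_const, Finset.card_range, nsmul_eq_mul] at this
    linarith
  have h5 : ∑ i ∈ Finset.range k, a (k - i) (T^[i] (T^[n] θ)) ≤ k * (k * L) := by
    have : ∀ i ∈ Finset.range k, a (k - i) (T^[i] (T^[n] θ)) ≤ k * L := by
      intro i hi
      have h6 := (abs_le.1 (hL (k - i) (T^[i] (T^[n] θ)))).2
      have h7 : ((k - i : ℕ) : ℝ) * L ≤ k * L := by gcongr; omega
      linarith
    have := Finset.sum_le_sum this
    simpa using this
  have h8 : k * a (k + n) θ ≤ k * ((k + n : ℕ) * c) := by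
    push_cast
    nlinarith
  exact le_of_mul_le_mul_left h8 hk0'

/-- A measurable coboundary which is bounded has zero integral. -/
theorem integral_coboundary_eq_zero [IsFiniteMeasure m] (hT : MeasurePreserving T m m)
    {u : Θ → ℝ} (hu : Measurable u) {L : ℝ} (hL : ∀ θ, |u θ - u (T θ)| ≤ L) (hu0 : ∀ θ, 0 ≤ u θ) :
    ∫ θ, (u θ - u (T θ)) ∂m = 0 := by
  have hmm : ∀ n : ℕ, Measurable fun θ => min (u θ) n := fun n => hu.min measurable_const
  have hint : ∀ n : ℕ, Integrable (fun θ => min (u θ) n) m := fun n =>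
    integrable_of_abs_le (L := n) (hmm n) fun θ => by
      rw [abs_of_nonneg (le_min (hu0 θ) (Nat.cast_nonneg n))]
      exact min_le_right _ _
  have hz : ∀ n : ℕ, ∫ θ, (min (u θ) n - min (u (T θ)) n) ∂m = 0 := fun n => by
    have h := integral_comp_measurePreserving hT (hmm n)
    have hint' : Integrable (fun θ => min (u (T θ)) n) m :=
      hT.integrable_comp_of_integrable (hint n)
    rw [integral_sub (hint n) hint']
    linarith
  have hlim := tendsto_integral_of_dominated_convergence (μ := m)
    (F := fun (n : ℕ) θ => min (u θ) n - min (u (T θ)) n) (f := fun θ => u θ - u (T θ))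
    (fun _ => L) (fun n => ((hmm n).sub ((hmm n).comp hT.measurable)).aestronglyMeasurable)
    (integrable_const _)
    (fun n => Eventually.of_forall fun θ => by
      refine le_trans ?_ (hL θ)
      rw [Real.norm_eq_abs]
      simpa using abs_min_sub_min_le_max (u θ) n (u (T θ)) n)
    (Eventually.of_forall fun θ => by
      refine tendsto_const_nhds.congr' ?_
      filter_upwards [eventually_ge_atTop (max ⌈u θ⌉₊ ⌈u (T θ)⌉₊)] with n hn
      rw [min_eq_left, min_eq_left]
      · exact (Nat.le_ceil _).trans (by exact_mod_cast (le_max_right _ _).trans hn)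
      · exact (Nat.le_ceil _).trans (by exact_mod_cast (le_max_left _ _).trans hn))
  simp only [hz] at hlim
  exact tendsto_nhds_unique hlim tendsto_const_nhds

theorem exists_isMax_of_tendsto_atBot {s : ℕ → ℝ} (hs : Tendsto s atTop atBot) :
    ∃ n, ∀ k, s k ≤ s n := by
  obtain ⟨N, hN⟩ := eventually_atTop.1 (hs.eventually_le_atBot (s 0))
  obtain ⟨n, -, hn⟩ := Finset.exists_max_image (Finset.range (N + 1)) s ⟨0, by simp⟩
  refine ⟨n, fun k => ?_⟩
  rcases le_or_gt k N with hk | hk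
  · exact hn k (by simp; omega)
  · exact (hN k hk.le).trans (hn 0 (by simp))

/-- Birkhoff sums of a bounded function of nonnegative mean do not tend to `-∞`. -/
theorem ae_not_tendsto_birkhoffSum_atBot [IsProbabilityMeasure m] (hT : Ergodic T m) {f : Θ → ℝ}
    (hf : Measurable f) {L : ℝ} (hL : ∀ θ, |f θ| ≤ L) (h0 : 0 ≤ ∫ θ, f θ ∂m) :
    ∀ᵐ θ ∂m, ¬ Tendsto (fun n => birkhoffSum T f n θ) atTop atBot := by
  let S : ℕ → Θ → ℝ := birkhoffSum T f
  have hS : ∀ n, Measurable (S n) := measurable_birkhoffSum hT.measurable hf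
  let E : Set Θ := {θ | Tendsto (fun n => S n θ) atTop atBot}
  have hE : MeasurableSet E := measurableSet_tendsto _ hS
  have hsucc : ∀ n θ, S (n + 1) θ = f θ + S n (T θ) := fun n θ => birkhoffSum_succ' T f n θ
  have hTE : T ⁻¹' E = E := by
    ext θ
    simp only [E, mem_preimage, mem_ofPred_eq]
    rw [← tendsto_add_atTop_iff_nat (f := fun n => S n θ) 1]
    simp only [hsucc]
    refine ⟨fun h => tendsto_atBot_add_const_left _ _ h, fun h => ?_⟩
    simpa using tendsto_atBot_add_const_left atTop (-f θ) h
  rcases hT.ae_mem_or_ae_notMem hE hTE with hae | hae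
  swap
  · exact hae
  exfalso
  let M : Θ → ℝ := fun θ => ⨆ n, S (n + 1) θ
  have hM : Measurable M := Measurable.iSup fun n => hS (n + 1)
  have hattain : ∀ θ ∈ E, ∃ n, M θ = S (n + 1) θ ∧ ∀ k, S (k + 1) θ ≤ M θ := by
    intro θ hθ
    obtain ⟨n, hn⟩ := exists_isMax_of_tendsto_atBot
      ((tendsto_add_atTop_iff_nat (f := fun n => S n θ) 1).2 hθ)
    have h1 : M θ = S (n + 1) θ := le_antisymm (ciSup_le hn)
      (le_ciSup (f := fun k => S (k + 1) θ) ⟨_, forall_mem_range.2 hn⟩ n)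
    exact ⟨n, h1, fun k => (hn k).trans h1.ge⟩
  have hrec : ∀ θ ∈ E, M θ = f θ + max (M (T θ)) 0 := by
    intro θ hθ
    have hθ' : T θ ∈ E := by rwa [← hTE] at hθ
    obtain ⟨n, hn, hn'⟩ := hattain θ hθ
    obtain ⟨k, hk, hk'⟩ := hattain _ hθ'
    apply le_antisymm
    · rw [hn, hsucc]
      gcongr
      rcases n with _ | n
      · simp [S]
      · exact (hk' n).trans (le_max_left _ _)
    · rcases max_cases (M (T θ)) 0 with ⟨h, -⟩ | ⟨h, -⟩
      · rw [h, hk, ← hsucc]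
        exact hn' _
      · have := hn' 0
        rw [hsucc] at this
        rw [h]
        simpa [S] using this
  let u : Θ → ℝ := E.indicator fun θ => max (M θ) 0
  have hu : Measurable u := (hM.max measurable_const).indicator hE
  have hmemT : ∀ θ, θ ∈ E → T θ ∈ E := fun θ hθ => by rwa [← hTE] at hθ
  have hnmemT : ∀ θ, θ ∉ E → T θ ∉ E := fun θ hθ => by rwa [← hTE] at hθ
  have hL0 : 0 ≤ L := by
    obtain ⟨θ⟩ : Nonempty Θ := m.nonempty_of_neZero
    exact (abs_nonneg _).trans (hL θ)
  have huval : ∀ θ ∈ E, u θ - u (T θ) = max (M θ) 0 - M θ + f θ := by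
    intro θ hθ
    have := hrec θ hθ
    simp only [u, indicator_of_mem hθ, indicator_of_mem (hmemT θ hθ)]
    linarith
  have hubd : ∀ θ, |u θ - u (T θ)| ≤ L := by
    intro θ
    by_cases hθ : θ ∈ E
    · rw [huval θ hθ]
      have h1 : f θ ≤ M θ := by
        rw [hrec θ hθ]
        linarith [le_max_right (M (T θ)) 0]
      have h2 := abs_le.1 (hL θ)
      rw [abs_le]
      rcases max_cases (M θ) 0 with ⟨h, h'⟩ | ⟨h, h'⟩ <;> rw [h] <;> constructor <;> linarith
    · simp only [u, indicator_of_notMem hθ, indicator_of_notMem (hnmemT θ hθ)]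
      simpa using hL0
  have hint := integral_coboundary_eq_zero hT.toMeasurePreserving hu hubd fun θ =>
    indicator_nonneg (fun _ _ => le_max_right _ _) θ
  have hfi : Integrable f m := integrable_of_abs_le hf hL
  have hui : Integrable (fun θ => u θ - u (T θ)) m :=
    integrable_of_abs_le (hu.sub (hu.comp hT.measurable)) hubd
  have hnn : 0 ≤ᵐ[m] fun θ => u θ - u (T θ) - f θ := by
    filter_upwards [hae] with θ hθ
    have := huval θ hθ
    simp only [Pi.zero_apply]
    linarith [le_max_left (M θ) 0]
  have hz : ∫ θ, (u θ - u (T θ) - f θ) ∂m = 0 := by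
    apply le_antisymm
    · rw [integral_sub hui hfi, hint]
      linarith
    · exact integral_nonneg_of_ae hnn
  have hz' := (integral_eq_zero_iff_of_nonneg_ae hnn (hui.sub hfi)).1 hz
  have hMnn : ∀ᵐ θ ∂m, 0 ≤ M θ := by
    filter_upwards [hz', hae] with θ h1 h2
    have h3 := huval θ h2
    simp only [Pi.zero_apply] at h1
    have h4 : max (M θ) 0 = M θ := by linarith
    exact max_eq_left_iff.1 h4
  have hall : ∀ᵐ θ ∂m, ∀ n : ℕ, 0 ≤ M (T^[n] θ) := ae_all_iff.2 fun n =>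
    (hT.toMeasurePreserving.quasiMeasurePreserving.iterate n).ae hMnn
  obtain ⟨θ, hθE, hθ⟩ := (hae.and hall).exists
  have hitE : ∀ n, T^[n] θ ∈ E := by
    intro n
    induction n with
    | zero => exact hθE
    | succ n ih => rw [Function.iterate_succ_apply']; exact hmemT _ ih
  have hlimθ : Tendsto (fun n => S n θ) atTop atBot := hθE
  obtain ⟨N, hN⟩ := eventually_atTop.1 (hlimθ.eventually_lt_atBot 0)
  have hbdd : BddAbove {n | 0 ≤ S n θ} := ⟨N, fun n hn => by
    by_contra hc
    exact absurd (hN n (not_le.1 hc).le) (not_lt.2 hn)⟩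
  have hmem := Nat.sSup_mem (s := {n | 0 ≤ S n θ}) ⟨0, by simp [S]⟩ hbdd
  set n := sSup {n | 0 ≤ S n θ}
  obtain ⟨k, hk, -⟩ := hattain _ (hitE n)
  have h1 : S (n + (k + 1)) θ = S n θ + S (k + 1) (T^[n] θ) := birkhoffSum_add T f n (k + 1) θ
  have h2 := hθ n
  have h3 : n + (k + 1) ≤ n := le_csSup hbdd (by
    have : 0 ≤ S n θ := hmem
    change 0 ≤ S (n + (k + 1)) θ
    linarith)
  omega

end Ergodic

section Plane

theorem mulVecE_zero_coord (M : Matrix (Fin 2) (Fin 2) ℝ) (v : R2) :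
    mulVecE M v 0 = M 0 0 * v 0 + M 0 1 * v 1 := by
  simp [mulVecE]

theorem mulVecE_one_coord (M : Matrix (Fin 2) (Fin 2) ℝ) (v : R2) :
    mulVecE M v 1 = M 1 0 * v 0 + M 1 1 * v 1 := by
  simp [mulVecE]

theorem R2.ext {v w : R2} (h0 : v 0 = w 0) (h1 : v 1 = w 1) : v = w := by
  ext i
  fin_cases i <;> assumption

theorem mulVecE_eq_toEuclideanCLM (M : Matrix (Fin 2) (Fin 2) ℝ) (v : R2) :
    mulVecE M v = (Matrix.toEuclideanCLM (𝕜 := ℝ) M : R2 →L[ℝ] R2) v := rfl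

theorem mulVecE_add (M : Matrix (Fin 2) (Fin 2) ℝ) (v w : R2) :
    mulVecE M (v + w) = mulVecE M v + mulVecE M w := by
  simp only [mulVecE_eq_toEuclideanCLM, map_add]

theorem mulVecE_smul (M : Matrix (Fin 2) (Fin 2) ℝ) (c : ℝ) (v : R2) :
    mulVecE M (c • v) = c • mulVecE M v := by
  simp only [mulVecE_eq_toEuclideanCLM, map_smul]

theorem mulVecE_zero (M : Matrix (Fin 2) (Fin 2) ℝ) : mulVecE M 0 = 0 := by
  simp only [mulVecE_eq_toEuclideanCLM, map_zero]

theorem mulVecE_mul (M N : Matrix (Fin 2) (Fin 2) ℝ) (v : R2) :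
    mulVecE (M * N) v = mulVecE M (mulVecE N v) := by
  apply R2.ext <;> simp only [mulVecE_zero_coord, mulVecE_one_coord, Matrix.mul_apply,
    Fin.sum_univ_two] <;> ring

theorem mulVecE_one (v : R2) : mulVecE 1 v = v := by
  simp [mulVecE]

theorem norm_mulVecE_le (M : Matrix (Fin 2) (Fin 2) ℝ) (v : R2) :
    ‖mulVecE M v‖ ≤ opNorm M * ‖v‖ :=
  (Matrix.toEuclideanCLM (𝕜 := ℝ) M : R2 →L[ℝ] R2).le_opNorm v

theorem opNorm_nonneg (M : Matrix (Fin 2) (Fin 2) ℝ) : 0 ≤ opNorm M := norm_nonneg _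

theorem opNorm_mul_le (M N : Matrix (Fin 2) (Fin 2) ℝ) : opNorm (M * N) ≤ opNorm M * opNorm N := by
  unfold opNorm
  rw [map_mul]
  exact norm_mul_le _ _

theorem opNorm_le_of {M : Matrix (Fin 2) (Fin 2) ℝ} {C : ℝ} (hC : 0 ≤ C)
    (h : ∀ v, ‖mulVecE M v‖ ≤ C * ‖v‖) : opNorm M ≤ C :=
  ContinuousLinearMap.opNorm_le_bound _ hC h

theorem R2.norm_sq (v : R2) : ‖v‖ ^ 2 = v 0 ^ 2 + v 1 ^ 2 := by
  rw [EuclideanSpace.real_norm_sq_eq, Fin.sum_univ_two]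

/-- The oriented area spanned by two plane vectors. -/
def wedge (v w : R2) : ℝ := v 0 * w 1 - v 1 * w 0

/-- Rotation by a quarter turn. -/
def rot (v : R2) : R2 := !₂[-v 1, v 0]

@[simp] theorem rot_zero_coord (v : R2) : rot v 0 = -v 1 := rfl

@[simp] theorem rot_one_coord (v : R2) : rot v 1 = v 0 := rfl

theorem norm_rot (v : R2) : ‖rot v‖ = ‖v‖ := by
  rw [← sq_eq_sq₀ (norm_nonneg _) (norm_nonneg _), R2.norm_sq, R2.norm_sq]
  simp
  ring

theorem wedge_rot (v : R2) : wedge v (rot v) = ‖v‖ ^ 2 := by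
  rw [R2.norm_sq]; simp [wedge]; ring

theorem abs_wedge_le (v w : R2) : |wedge v w| ≤ ‖v‖ * ‖w‖ := by
  rw [← abs_of_nonneg (mul_nonneg (norm_nonneg v) (norm_nonneg w)), ← sq_le_sq, mul_pow,
    R2.norm_sq, R2.norm_sq, wedge]
  nlinarith [sq_nonneg (v 0 * w 0 + v 1 * w 1)]

theorem wedge_mulVecE (M : Matrix (Fin 2) (Fin 2) ℝ) (v w : R2) :
    wedge (mulVecE M v) (mulVecE M w) = M.det * wedge v w := by
  simp only [wedge, mulVecE_zero_coord, mulVecE_one_coord, Matrix.det_fin_two]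
  ring

theorem wedge_smul_left (c : ℝ) (v w : R2) : wedge (c • v) w = c * wedge v w := by
  simp [wedge]; ring

theorem wedge_smul_right (c : ℝ) (v w : R2) : wedge v (c • w) = c * wedge v w := by
  simp [wedge]; ring

theorem wedge_self (v : R2) : wedge v v = 0 := by
  simp [wedge]; ring

theorem abs_wedge_le_mul_norm {M : Matrix (Fin 2) (Fin 2) ℝ} (hM : M.det = 1) (v w : R2) :
    |wedge v w| ≤ ‖mulVecE M v‖ * ‖mulVecE M w‖ := by
  have := abs_wedge_le (mulVecE M v) (mulVecE M w)
  rwa [wedge_mulVecE, hM, one_mul] at this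

theorem norm_le_opNorm_mul {M : Matrix (Fin 2) (Fin 2) ℝ} (hM : M.det = 1) (v : R2) :
    ‖v‖ ≤ opNorm M * ‖mulVecE M v‖ := by
  rcases eq_or_lt_of_le (norm_nonneg v) with h | h
  · rw [← h]
    exact mul_nonneg (opNorm_nonneg _) (norm_nonneg _)
  · have h1 := abs_wedge_le_mul_norm hM v (rot v)
    have h2 := norm_mulVecE_le M (rot v)
    rw [norm_rot] at h2
    rw [wedge_rot, abs_of_nonneg (sq_nonneg _)] at h1
    have h3 : ‖v‖ * ‖v‖ ≤ (opNorm M * ‖mulVecE M v‖) * ‖v‖ := by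
      calc ‖v‖ * ‖v‖ = ‖v‖ ^ 2 := by ring
        _ ≤ ‖mulVecE M v‖ * ‖mulVecE M (rot v)‖ := h1
        _ ≤ ‖mulVecE M v‖ * (opNorm M * ‖v‖) := by gcongr
        _ = _ := by ring
    exact le_of_mul_le_mul_right h3 h

theorem exists_unit : ∃ v : R2, ‖v‖ = 1 := ⟨EuclideanSpace.single 0 1, by simp⟩

theorem one_le_opNorm {M : Matrix (Fin 2) (Fin 2) ℝ} (hM : M.det = 1) : 1 ≤ opNorm M := by
  obtain ⟨v, hv⟩ := exists_unit
  have h1 := norm_le_opNorm_mul hM v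
  have h2 := norm_mulVecE_le M v
  rw [hv] at h1 h2
  have := opNorm_nonneg M
  nlinarith

theorem mulVecE_ne_zero {M : Matrix (Fin 2) (Fin 2) ℝ} (hM : M.det = 1) {v : R2} (hv : v ≠ 0) :
    mulVecE M v ≠ 0 := by
  intro h
  have := norm_le_opNorm_mul hM v
  rw [h, norm_zero, mul_zero] at this
  exact hv (norm_le_zero_iff.1 this)

theorem mulVecE_inv_mulVecE {M : Matrix (Fin 2) (Fin 2) ℝ} (hM : M.det = 1) (v : R2) :
    mulVecE M⁻¹ (mulVecE M v) = v := by
  rw [← mulVecE_mul, Matrix.nonsing_inv_mul _ (by simp [hM]), mulVecE_one]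

theorem mulVecE_mulVecE_inv {M : Matrix (Fin 2) (Fin 2) ℝ} (hM : M.det = 1) (v : R2) :
    mulVecE M (mulVecE M⁻¹ v) = v := by
  rw [← mulVecE_mul, Matrix.mul_nonsing_inv _ (by simp [hM]), mulVecE_one]

theorem det_inv_eq_one {M : Matrix (Fin 2) (Fin 2) ℝ} (hM : M.det = 1) : M⁻¹.det = 1 := by
  rw [Matrix.det_nonsing_inv, hM]; simp

theorem opNorm_inv {M : Matrix (Fin 2) (Fin 2) ℝ} (hM : M.det = 1) : opNorm M⁻¹ = opNorm M := by
  have key : ∀ N : Matrix (Fin 2) (Fin 2) ℝ, N.det = 1 → opNorm N⁻¹ ≤ opNorm N := fun N hN =>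
    opNorm_le_of (opNorm_nonneg _) fun v => by
      have := norm_le_opNorm_mul hN (mulVecE N⁻¹ v)
      rwa [mulVecE_mulVecE_inv hN] at this
  refine le_antisymm (key M hM) ?_
  have := key _ (det_inv_eq_one hM)
  rwa [Matrix.nonsing_inv_nonsing_inv _ (by simp [hM])] at this

theorem opNorm_one_le : opNorm 1 ≤ 1 :=
  opNorm_le_of zero_le_one fun v => by rw [mulVecE_one, one_mul]

theorem measurable_opNorm {Θ : Type*} [MeasurableSpace Θ] {A : Θ → Matrix (Fin 2) (Fin 2) ℝ}
    (hA : ∀ i j, Measurable fun θ => A θ i j) : Measurable fun θ => opNorm (A θ) := by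
  have h1 : Continuous (opNorm : Matrix (Fin 2) (Fin 2) ℝ → ℝ) := by
    have : Continuous fun M : Matrix (Fin 2) (Fin 2) ℝ =>
        (Matrix.toEuclideanCLM (𝕜 := ℝ) M : R2 →L[ℝ] R2) :=
      LinearMap.continuous_of_finiteDimensional
        (Matrix.toEuclideanCLM (n := Fin 2) (𝕜 := ℝ)).toAlgEquiv.toLinearMap
    exact this.norm
  have h2 : Measurable fun θ => (fun i j => A θ i j : Fin 2 → Fin 2 → ℝ) :=
    measurable_pi_lambda _ fun i => measurable_pi_lambda _ fun j => hA i j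
  have h3 : Continuous fun M : Fin 2 → Fin 2 → ℝ => opNorm (Matrix.of M) := h1
  exact h3.measurable.comp h2

/-- A vector, measurable in the matrix, which is nearly optimally contracted. -/
def contracted (M : Matrix (Fin 2) (Fin 2) ℝ) : R2 :=
  if M 0 0 ^ 2 + M 0 1 ^ 2 ≤ M 1 0 ^ 2 + M 1 1 ^ 2 then !₂[M 1 1, -M 1 0] else !₂[-M 0 1, M 0 0]

theorem norm_mulVecE_contracted {M : Matrix (Fin 2) (Fin 2) ℝ} (hM : M.det = 1) :
    ‖mulVecE M (contracted M)‖ = 1 := by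
  rw [← sq_eq_sq₀ (norm_nonneg _) zero_le_one, R2.norm_sq, mulVecE_zero_coord, mulVecE_one_coord]
  rw [Matrix.det_fin_two] at hM
  unfold contracted
  split_ifs
  · simp
    linear_combination (M 0 0 * M 1 1 - M 0 1 * M 1 0 + 1) * hM
  · simp
    linear_combination (M 0 0 * M 1 1 - M 0 1 * M 1 0 + 1) * hM

theorem opNorm_le_contracted (M : Matrix (Fin 2) (Fin 2) ℝ) :
    opNorm M ≤ 2 * ‖contracted M‖ := by
  refine opNorm_le_of (by positivity) fun v => ?_
  rw [← sq_le_sq₀ (norm_nonneg _) (by positivity), mul_pow, mul_pow, R2.norm_sq, R2.norm_sq,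
    R2.norm_sq v, mulVecE_zero_coord, mulVecE_one_coord]
  have h1 : (M 0 0 * v 0 + M 0 1 * v 1) ^ 2 ≤
      (M 0 0 ^ 2 + M 0 1 ^ 2) * (v 0 ^ 2 + v 1 ^ 2) := by
    nlinarith [sq_nonneg (M 0 0 * v 1 - M 0 1 * v 0)]
  have h2 : (M 1 0 * v 0 + M 1 1 * v 1) ^ 2 ≤
      (M 1 0 ^ 2 + M 1 1 ^ 2) * (v 0 ^ 2 + v 1 ^ 2) := by
    nlinarith [sq_nonneg (M 1 0 * v 1 - M 1 1 * v 0)]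
  have h3 : 0 ≤ v 0 ^ 2 + v 1 ^ 2 := by positivity
  have hp : 0 ≤ M 1 0 ^ 2 + M 1 1 ^ 2 := by positivity
  have hq : 0 ≤ M 0 0 ^ 2 + M 0 1 ^ 2 := by positivity
  unfold contracted
  split_ifs with h
  · simp
    nlinarith [mul_le_mul_of_nonneg_right h h3, mul_nonneg hp h3]
  · simp
    nlinarith [mul_le_mul_of_nonneg_right (not_le.1 h).le h3, mul_nonneg hq h3]

theorem norm_mulVecE_le_add {M : Matrix (Fin 2) (Fin 2) ℝ} {v w : R2} (hv : ‖v‖ = 1)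
    (hw : ‖w‖ = 1) : ‖mulVecE M v‖ ≤ ‖mulVecE M w‖ + |wedge v w| * opNorm M := by
  have hw2 := R2.norm_sq w
  have hv2 := R2.norm_sq v
  rw [hw] at hw2
  rw [hv] at hv2
  have hdec : v = (v 0 * w 0 + v 1 * w 1) • w + (-wedge v w) • rot w := by
    apply R2.ext <;> simp [wedge]
    · linear_combination (v 0) * hw2
    · linear_combination (v 1) * hw2
  have hc : |v 0 * w 0 + v 1 * w 1| ≤ 1 := by
    rw [abs_le]
    constructor <;> nlinarith [sq_nonneg (v 0 - w 0), sq_nonneg (v 1 - w 1),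
      sq_nonneg (v 0 + w 0), sq_nonneg (v 1 + w 1)]
  have h1 := norm_mulVecE_le M (rot w)
  rw [norm_rot, hw, mul_one] at h1
  calc ‖mulVecE M v‖
      = ‖(v 0 * w 0 + v 1 * w 1) • mulVecE M w + (-wedge v w) • mulVecE M (rot w)‖ := by
        conv_lhs => rw [hdec, mulVecE_add, mulVecE_smul, mulVecE_smul]
    _ ≤ |v 0 * w 0 + v 1 * w 1| * ‖mulVecE M w‖ + |wedge v w| * ‖mulVecE M (rot w)‖ := by
        refine (norm_add_le _ _).trans ?_
        rw [norm_smul, norm_smul, Real.norm_eq_abs, Real.norm_eq_abs, abs_neg]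
    _ ≤ 1 * ‖mulVecE M w‖ + |wedge v w| * opNorm M := by gcongr
    _ = _ := by rw [one_mul]

theorem eq_smul_of_wedge_eq_zero {v w : R2} (hw : w ≠ 0) (h : wedge v w = 0) :
    ∃ c : ℝ, v = c • w := by
  have hw2 := R2.norm_sq w
  have hw0 : ‖w‖ ^ 2 ≠ 0 := by simpa using hw
  unfold wedge at h
  refine ⟨(v 0 * w 0 + v 1 * w 1) / ‖w‖ ^ 2, ?_⟩
  apply R2.ext <;> simp only [PiLp.smul_apply, smul_eq_mul] <;> field_simp <;> rw [hw2]
  · linear_combination (w 1) * h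
  · linear_combination (-w 0) * h

/-- The square of a plane vector viewed as a complex number; it determines the line it spans. -/
def cSq (v : R2) : ℂ := ((v 0 : ℂ) + (v 1 : ℂ) * Complex.I) ^ 2

theorem norm_cSq (v : R2) : ‖cSq v‖ = ‖v‖ ^ 2 := by
  rw [cSq, norm_pow, Complex.sq_norm, R2.norm_sq, Complex.normSq_add_mul_I]

theorem norm_cSq_sub {v w : R2} (hv : ‖v‖ = 1) (hw : ‖w‖ = 1) :
    ‖cSq v - cSq w‖ = 2 * |wedge v w| := by
  have hw2 := R2.norm_sq w
  have hv2 := R2.norm_sq v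
  rw [hw] at hw2
  rw [hv] at hv2
  rw [← sq_eq_sq₀ (norm_nonneg _) (by positivity), mul_pow, sq_abs, Complex.sq_norm]
  have : cSq v - cSq w = ((v 0 ^ 2 - v 1 ^ 2 - (w 0 ^ 2 - w 1 ^ 2) : ℝ) : ℂ) +
      ((2 * (v 0 * v 1) - 2 * (w 0 * w 1) : ℝ) : ℂ) * Complex.I := by
    simp only [cSq]
    push_cast
    linear_combination ((v 1 : ℂ) ^ 2 - (w 1 : ℂ) ^ 2) * Complex.I_sq
  rw [this, Complex.normSq_add_mul_I, wedge]
  have hv4 : (v 0 ^ 2 + v 1 ^ 2) ^ 2 = 1 := by rw [← hv2]; norm_num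
  have hw4 : (w 0 ^ 2 + w 1 ^ 2) ^ 2 = 1 := by rw [← hw2]; norm_num
  have hvw : (v 0 ^ 2 + v 1 ^ 2) * (w 0 ^ 2 + w 1 ^ 2) = 1 := by rw [← hv2, ← hw2]; norm_num
  linear_combination hv4 + hw4 - 2 * hvw

/-- The angle in `[0, 1/2)` of the line whose unit vectors square to `z`. -/
def lineAngle (z : ℂ) : ℝ := Int.fract (Complex.arg z / (2 * Real.pi)) / 2

theorem lineAngle_mem (z : ℂ) : lineAngle z ∈ Set.Ico (0 : ℝ) (1 / 2) := by
  unfold lineAngle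
  have h1 := Int.fract_nonneg (Complex.arg z / (2 * Real.pi))
  have h2 := Int.fract_lt_one (Complex.arg z / (2 * Real.pi))
  constructor <;> linarith

theorem measurable_lineAngle : Measurable lineAngle :=
  ((Complex.measurable_arg.div_const _).fract).div_const _

theorem norm_vFull (α : ℝ) : ‖vFull α‖ = 1 := by
  rw [← sq_eq_sq₀ (norm_nonneg _) zero_le_one, R2.norm_sq]
  simp [vFull]

theorem cSq_vFull (α : ℝ) :
    cSq (vFull α) = Complex.exp ((2 * (2 * Real.pi * α) : ℝ) * Complex.I) := by
  rw [show ((2 * (2 * Real.pi * α) : ℝ) * Complex.I : ℂ) =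
    (2 : ℕ) * (((2 * Real.pi * α : ℝ) : ℂ) * Complex.I) by push_cast; ring, Complex.exp_nat_mul,
    Complex.exp_mul_I]
  simp [cSq, vFull]

theorem cSq_vFull_lineAngle {z : ℂ} (hz : ‖z‖ = 1) : cSq (vFull (lineAngle z)) = z := by
  rw [cSq_vFull, lineAngle, Int.fract]
  set k := ⌊Complex.arg z / (2 * Real.pi)⌋
  have : ((2 * (2 * Real.pi * ((Complex.arg z / (2 * Real.pi) - k) / 2)) : ℝ) * Complex.I : ℂ) =
      Complex.arg z * Complex.I - k * (2 * Real.pi * Complex.I) := by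
    have : (2 * (2 * Real.pi * ((Complex.arg z / (2 * Real.pi) - k) / 2)) : ℝ) =
        Complex.arg z - k * (2 * Real.pi) := by
      field_simp
    rw [this]
    push_cast
    ring
  rw [this, Complex.exp_sub, Complex.exp_int_mul_two_pi_mul_I, div_one]
  have := Complex.norm_mul_exp_arg_mul_I z
  rwa [hz, Complex.ofReal_one, one_mul] at this

end Plane

section Cocycle

variable {Θ : Type*} {γ : Θ → Θ} {A : Θ → Matrix (Fin 2) (Fin 2) ℝ}

theorem coc_add (n k : ℕ) (θ : Θ) : coc γ A (n + k) θ = coc γ A k (γ^[n] θ) * coc γ A n θ := by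
  induction n generalizing θ with
  | zero => simp [coc]
  | succ n ih =>
    rw [show n + 1 + k = (n + k) + 1 by ring, coc, ih, coc, Function.iterate_succ_apply, mul_assoc]

theorem coc_one (θ : Θ) : coc γ A 1 θ = A θ := by simp [coc]

theorem coc_succ_left (n : ℕ) (θ : Θ) :
    coc γ A (n + 1) θ = A (γ^[n] θ) * coc γ A n θ := by
  rw [coc_add, coc_one]

theorem det_coc (hdet : ∀ θ, (A θ).det = 1) (n : ℕ) (θ : Θ) : (coc γ A n θ).det = 1 := by
  induction n generalizing θ with
  | zero => simp [coc]
  | succ n ih => rw [coc, Matrix.det_mul, ih, hdet, one_mul]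

theorem one_le_of_opNorm_le (hdet : ∀ θ, (A θ).det = 1) {C : ℝ} (hC : ∀ θ, opNorm (A θ) ≤ C)
    (θ : Θ) : 1 ≤ C := (one_le_opNorm (hdet θ)).trans (hC θ)

theorem opNorm_coc_le (hdet : ∀ θ, (A θ).det = 1) {C : ℝ} (hC : ∀ θ, opNorm (A θ) ≤ C) (n : ℕ)
    (θ : Θ) : opNorm (coc γ A n θ) ≤ C ^ n := by
  have h1 := one_le_of_opNorm_le hdet hC θ
  induction n generalizing θ with
  | zero => simpa [coc] using opNorm_one_le
  | succ n ih =>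
    rw [coc, pow_succ]
    refine (opNorm_mul_le _ _).trans ?_
    have := opNorm_nonneg (A θ)
    gcongr
    · exact ih _
    · exact hC θ

theorem abs_log_opNorm_coc_le (hdet : ∀ θ, (A θ).det = 1) {C : ℝ} (hC : ∀ θ, opNorm (A θ) ≤ C)
    (n : ℕ) (θ : Θ) : |Real.log (opNorm (coc γ A n θ))| ≤ n * Real.log C := by
  have h1 := one_le_opNorm (det_coc (γ := γ) hdet n θ)
  rw [abs_of_nonneg (Real.log_nonneg h1), ← Real.log_pow]
  exact Real.log_le_log (by linarith) (opNorm_coc_le hdet hC n θ)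

theorem log_opNorm_coc_add_le (hdet : ∀ θ, (A θ).det = 1) (n k : ℕ) (θ : Θ) :
    Real.log (opNorm (coc γ A (n + k) θ)) ≤
      Real.log (opNorm (coc γ A n θ)) + Real.log (opNorm (coc γ A k (γ^[n] θ))) := by
  have h1 := one_le_opNorm (det_coc (γ := γ) hdet n θ)
  have h2 := one_le_opNorm (det_coc (γ := γ) hdet k (γ^[n] θ))
  have h3 := one_le_opNorm (det_coc (γ := γ) hdet (n + k) θ)
  rw [← Real.log_mul (by linarith) (by linarith)]
  refine Real.log_le_log (by linarith) ?_
  rw [coc_add, mul_comm (opNorm _)]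
  exact opNorm_mul_le _ _

theorem log_opNorm_coc_shift (hdet : ∀ θ, (A θ).det = 1) {C : ℝ} (hC : ∀ θ, opNorm (A θ) ≤ C)
    (n : ℕ) (θ : Θ) : Real.log (opNorm (coc γ A n (γ θ))) ≤
      Real.log (opNorm (coc γ A (n + 1) θ)) + Real.log C := by
  have h1 := one_le_opNorm (det_coc (γ := γ) hdet n (γ θ))
  have h2 := one_le_of_opNorm_le hdet hC θ
  have h3 := one_le_opNorm (det_coc (γ := γ) hdet (n + 1) θ)
  rw [← Real.log_mul (by linarith) (by linarith)]
  refine Real.log_le_log (by linarith) ?_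
  have : coc γ A n (γ θ) = coc γ A (n + 1) θ * (A θ)⁻¹ := by
    rw [coc, mul_assoc, Matrix.mul_nonsing_inv _ (by simp [hdet]), mul_one]
  rw [this]
  refine (opNorm_mul_le _ _).trans ?_
  rw [opNorm_inv (hdet θ)]
  gcongr
  exact hC θ

/-- Growth along an invariant line field is given by a Birkhoff sum. -/
theorem coc_smul_of_invariant (hdet : ∀ θ, (A θ).det = 1) {s : Θ → R2} (hs : ∀ θ, ‖s θ‖ = 1)
    {θ : Θ} (hinv : ∀ k, ∃ p : ℝ, mulVecE (A (γ^[k] θ)) (s (γ^[k] θ)) = p • s (γ (γ^[k] θ)))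
    (n : ℕ) : ∃ P : ℝ, mulVecE (coc γ A n θ) (s θ) = P • s (γ^[n] θ) ∧ P ≠ 0 ∧
      Real.log |P| = birkhoffSum γ (fun θ => Real.log ‖mulVecE (A θ) (s θ)‖) n θ := by
  induction n with
  | zero => exact ⟨1, by simp [coc, mulVecE_one], one_ne_zero, by simp⟩
  | succ n ih =>
    obtain ⟨P, hP, hP0, hPlog⟩ := ih
    obtain ⟨p, hp⟩ := hinv n
    have hpn : ‖mulVecE (A (γ^[n] θ)) (s (γ^[n] θ))‖ = |p| := by
      rw [hp, norm_smul, hs, mul_one, Real.norm_eq_abs]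
    have hp0 : p ≠ 0 := by
      rintro rfl
      rw [abs_zero, norm_eq_zero] at hpn
      exact mulVecE_ne_zero (hdet _) (by rw [← norm_ne_zero_iff, hs]; exact one_ne_zero) hpn
    refine ⟨P * p, ?_, mul_ne_zero hP0 hp0, ?_⟩
    · rw [coc_succ_left, mulVecE_mul, hP, mulVecE_smul, hp, smul_smul, Function.iterate_succ_apply']
    · rw [birkhoffSum_succ, hpn, ← hPlog, abs_mul, Real.log_mul (by simpa) (by simpa)]

theorem abs_log_norm_mulVecE_le (hdet : ∀ θ, (A θ).det = 1) {C : ℝ} (hC : ∀ θ, opNorm (A θ) ≤ C)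
    {v : R2} (hv : ‖v‖ = 1) (θ : Θ) : |Real.log ‖mulVecE (A θ) v‖| ≤ Real.log C := by
  have h1 := norm_le_opNorm_mul (hdet θ) v
  have h2 := norm_mulVecE_le (A θ) v
  have h3 := one_le_of_opNorm_le hdet hC θ
  have h4 := hC θ
  have h0 : 0 < ‖mulVecE (A θ) v‖ :=
    norm_pos_iff.2 (mulVecE_ne_zero (hdet θ) (by rw [← norm_ne_zero_iff, hv]; exact one_ne_zero))
  rw [hv] at h1 h2
  rw [abs_le]
  constructor
  · rw [neg_le_iff_add_nonneg, ← Real.log_mul (by positivity) (by linarith)]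
    refine Real.log_nonneg (h1.trans ?_)
    rw [mul_comm]
    gcongr
  · exact Real.log_le_log h0 (by linarith)

variable [MeasurableSpace Θ] {m : Measure Θ}

theorem measurable_coc (hγ : Measurable γ) (hA : ∀ i j, Measurable fun θ => A θ i j) (n : ℕ) :
    ∀ i j, Measurable fun θ => coc γ A n θ i j := by
  induction n with
  | zero => intro i j; simp only [coc]; exact measurable_const
  | succ n ih =>
    intro i j
    simp only [coc, Matrix.mul_apply, Fin.sum_univ_two]
    exact (((ih i 0).comp hγ).mul (hA 0 j)).add (((ih i 1).comp hγ).mul (hA 1 j))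

theorem measurable_log_opNorm_coc (hγ : Measurable γ) (hA : ∀ i j, Measurable fun θ => A θ i j)
    (n : ℕ) : Measurable fun θ => Real.log (opNorm (coc γ A n θ)) :=
  Real.measurable_log.comp (measurable_opNorm (measurable_coc hγ hA n))

theorem measurable_norm_mulVecE (hA : ∀ i j, Measurable fun θ => A θ i j) {v : Θ → R2}
    (hv : ∀ i, Measurable fun θ => v θ i) : Measurable fun θ => ‖mulVecE (A θ) (v θ)‖ := by
  have : (fun θ => ‖mulVecE (A θ) (v θ)‖) = fun θ => √((A θ 0 0 * v θ 0 + A θ 0 1 * v θ 1) ^ 2 +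
      (A θ 1 0 * v θ 0 + A θ 1 1 * v θ 1) ^ 2) := by
    funext θ
    rw [← mulVecE_zero_coord, ← mulVecE_one_coord, ← R2.norm_sq, Real.sqrt_sq (norm_nonneg _)]
  rw [this]
  exact (((((hA 0 0).mul (hv 0)).add ((hA 0 1).mul (hv 1))).pow_const 2).add
    ((((hA 1 0).mul (hv 0)).add ((hA 1 1).mul (hv 1))).pow_const 2)).sqrt

theorem measurable_vFull_coord {α : Θ → ℝ} (hα : Measurable α) (i : Fin 2) :
    Measurable fun θ => vFull (α θ) i := by
  fin_cases i
  · simpa [vFull, Function.comp_def] using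
      Real.measurable_cos.comp (hα.const_mul (2 * Real.pi))
  · simpa [vFull, Function.comp_def] using
      Real.measurable_sin.comp (hα.const_mul (2 * Real.pi))

theorem tendsto_of_eventually_dist_le_geometric {z : ℕ → ℂ} {K r : ℝ} (hr : r < 1)
    (hz : ∀ᶠ n in atTop, dist (z n) (z (n + 1)) ≤ K * r ^ n) :
    ∃ l, Tendsto z atTop (𝓝 l) ∧ ∀ᶠ n in atTop, dist (z n) l ≤ K * r ^ n / (1 - r) := by
  obtain ⟨N, hN⟩ := eventually_atTop.1 hz
  have hgeo : ∀ M, N ≤ M → ∀ n, dist (z (n + M)) (z (n + 1 + M)) ≤ K * r ^ M * r ^ n := by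
    intro M hM n
    have := hN (n + M) (by omega)
    rw [show n + 1 + M = n + M + 1 by ring]
    refine this.trans (le_of_eq ?_)
    rw [pow_add]; ring
  obtain ⟨l, hl⟩ := cauchySeq_tendsto_of_complete
    (cauchySeq_of_le_geometric r _ hr (hgeo N le_rfl))
  rw [tendsto_add_atTop_iff_nat] at hl
  refine ⟨l, hl, eventually_atTop.2 ⟨N, fun M hM => ?_⟩⟩
  have := dist_le_of_le_geometric_of_tendsto₀ r _ hr (hgeo M hM)
    ((tendsto_add_atTop_iff_nat (f := z) M).2 hl)
  simpa using this

/-- The normalization of `contracted (coc γ A n θ)`. -/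
def contractedDir (γ : Θ → Θ) (A : Θ → Matrix (Fin 2) (Fin 2) ℝ) (n : ℕ) (θ : Θ) : R2 :=
  ‖contracted (coc γ A n θ)‖⁻¹ • contracted (coc γ A n θ)

end Cocycle

section StableLine

variable {Θ : Type*} {γ : Θ → Θ} {A : Θ → Matrix (Fin 2) (Fin 2) ℝ}

theorem norm_contracted_pos {M : Matrix (Fin 2) (Fin 2) ℝ} (hM : M.det = 1) :
    0 < ‖contracted M‖ := by
  have h1 := opNorm_le_contracted M
  have h2 := one_le_opNorm hM
  linarith

theorem norm_contractedDir (hdet : ∀ θ, (A θ).det = 1) (n : ℕ) (θ : Θ) :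
    ‖contractedDir γ A n θ‖ = 1 := by
  have := norm_contracted_pos (det_coc (γ := γ) hdet n θ)
  rw [contractedDir, norm_smul, norm_inv, norm_norm, inv_mul_cancel₀ this.ne']

theorem norm_coc_contractedDir_le (hdet : ∀ θ, (A θ).det = 1) (n : ℕ) (θ : Θ) :
    ‖mulVecE (coc γ A n θ) (contractedDir γ A n θ)‖ ≤ 2 / opNorm (coc γ A n θ) := by
  have h0 := norm_contracted_pos (det_coc (γ := γ) hdet n θ)
  have h1 := opNorm_le_contracted (coc γ A n θ)
  have h2 := one_le_opNorm (det_coc (γ := γ) hdet n θ)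
  rw [contractedDir, mulVecE_smul, norm_smul, norm_inv, norm_norm,
    norm_mulVecE_contracted (det_coc hdet n θ), mul_one, le_div_iff₀ (by linarith),
    inv_mul_le_iff₀ h0]
  linarith

theorem abs_wedge_contractedDir_le (hdet : ∀ θ, (A θ).det = 1) {C : ℝ}
    (hC : ∀ θ, opNorm (A θ) ≤ C) (n : ℕ) (θ : Θ) :
    |wedge (contractedDir γ A n θ) (contractedDir γ A (n + 1) θ)| ≤
      4 * C ^ 2 / opNorm (coc γ A n θ) ^ 2 := by
  have hC1 := one_le_of_opNorm_le hdet hC θ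
  have h2 := one_le_opNorm (det_coc (γ := γ) hdet n θ)
  have h3 := one_le_opNorm (det_coc (γ := γ) hdet (n + 1) θ)
  have h4 := norm_coc_contractedDir_le (γ := γ) hdet n θ
  have h5 : ‖mulVecE (coc γ A n θ) (contractedDir γ A (n + 1) θ)‖ ≤
      C * (2 / opNorm (coc γ A (n + 1) θ)) := by
    refine (norm_le_opNorm_mul (hdet (γ^[n] θ)) _).trans ?_
    rw [← mulVecE_mul, ← coc_succ_left]
    exact mul_le_mul (hC _) (norm_coc_contractedDir_le hdet _ _) (norm_nonneg _) (by linarith)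
  have h6 : opNorm (coc γ A n θ) ≤ C * opNorm (coc γ A (n + 1) θ) := by
    have : coc γ A n θ = (A (γ^[n] θ))⁻¹ * coc γ A (n + 1) θ := by
      rw [coc_succ_left, ← mul_assoc, Matrix.nonsing_inv_mul _ (by simp [hdet]), one_mul]
    rw [this]
    refine (opNorm_mul_le _ _).trans ?_
    rw [opNorm_inv (hdet _)]
    gcongr
    exact hC _
  have h7 : C * (2 / opNorm (coc γ A (n + 1) θ)) ≤ 2 * C ^ 2 / opNorm (coc γ A n θ) := by
    rw [← mul_div_assoc, div_le_div_iff₀ (by linarith) (by linarith)]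
    nlinarith
  refine (abs_wedge_le_mul_norm (det_coc (γ := γ) hdet n θ) _ _).trans ?_
  calc _ ≤ 2 / opNorm (coc γ A n θ) * (2 * C ^ 2 / opNorm (coc γ A n θ)) :=
        mul_le_mul h4 (h5.trans h7) (norm_nonneg _) (by positivity)
    _ = _ := by field_simp; ring

theorem exists_limit_contractedDir (hdet : ∀ θ, (A θ).det = 1) {C : ℝ}
    (hC : ∀ θ, opNorm (A θ) ≤ C) {c : ℝ} (hc : 0 < c) {θ : Θ}
    (hθ : ∀ᶠ n : ℕ in atTop, n * c ≤ Real.log (opNorm (coc γ A n θ))) :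
    ∃ l, Tendsto (fun n => cSq (contractedDir γ A n θ)) atTop (𝓝 l) ∧ ∀ᶠ n in atTop,
      dist (cSq (contractedDir γ A n θ)) l ≤
        8 * C ^ 2 * Real.exp (-(2 * c)) ^ n / (1 - Real.exp (-(2 * c))) := by
  refine tendsto_of_eventually_dist_le_geometric (Real.exp_lt_one_iff.2 (by linarith)) ?_
  filter_upwards [hθ] with n hn
  have h2 := one_le_opNorm (det_coc (γ := γ) hdet n θ)
  rw [dist_eq_norm, norm_cSq_sub (norm_contractedDir hdet _ _) (norm_contractedDir hdet _ _)]
  have h3 : Real.exp (n * c) ≤ opNorm (coc γ A n θ) := (Real.le_log_iff_exp_le (by linarith)).1 hn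
  have h4 : (opNorm (coc γ A n θ) ^ 2)⁻¹ ≤ Real.exp (-(2 * c)) ^ n := by
    rw [← Real.exp_nat_mul, show (n * -(2 * c) : ℝ) = -(2 * (n * c)) by ring, Real.exp_neg,
      show (2 * (n * c) : ℝ) = (2 : ℕ) * (n * c) by push_cast; ring, Real.exp_nat_mul]
    gcongr
  calc _ ≤ 2 * (4 * C ^ 2 / opNorm (coc γ A n θ) ^ 2) := by
        gcongr; exact abs_wedge_contractedDir_le hdet hC n θ
    _ = 8 * C ^ 2 * (opNorm (coc γ A n θ) ^ 2)⁻¹ := by rw [div_eq_mul_inv]; ring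
    _ ≤ _ := by gcongr

variable [MeasurableSpace Θ] {m : Measure Θ}

theorem measurable_cSq_contractedDir (hγ : Measurable γ)
    (hA : ∀ i j, Measurable fun θ => A θ i j) (n : ℕ) :
    Measurable fun θ => cSq (contractedDir γ A n θ) := by
  have hM := measurable_coc hγ hA n
  have hset : MeasurableSet {θ | coc γ A n θ 0 0 ^ 2 + coc γ A n θ 0 1 ^ 2 ≤
      coc γ A n θ 1 0 ^ 2 + coc γ A n θ 1 1 ^ 2} :=
    measurableSet_le (((hM 0 0).pow_const 2).add ((hM 0 1).pow_const 2))
      (((hM 1 0).pow_const 2).add ((hM 1 1).pow_const 2))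
  have h0 : Measurable fun θ => contracted (coc γ A n θ) 0 := by
    have : (fun θ => contracted (coc γ A n θ) 0) = fun θ =>
        if coc γ A n θ 0 0 ^ 2 + coc γ A n θ 0 1 ^ 2 ≤ coc γ A n θ 1 0 ^ 2 + coc γ A n θ 1 1 ^ 2
        then coc γ A n θ 1 1 else - coc γ A n θ 0 1 := by
      funext θ; unfold contracted; split_ifs <;> simp
    rw [this]
    exact Measurable.ite hset (hM 1 1) (hM 0 1).neg
  have h1 : Measurable fun θ => contracted (coc γ A n θ) 1 := by
    have : (fun θ => contracted (coc γ A n θ) 1) = fun θ =>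
        if coc γ A n θ 0 0 ^ 2 + coc γ A n θ 0 1 ^ 2 ≤ coc γ A n θ 1 0 ^ 2 + coc γ A n θ 1 1 ^ 2
        then - coc γ A n θ 1 0 else coc γ A n θ 0 0 := by
      funext θ; unfold contracted; split_ifs <;> simp
    rw [this]
    exact Measurable.ite hset (hM 1 0).neg (hM 0 0)
  have hn : Measurable fun θ => ‖contracted (coc γ A n θ)‖ := by
    have : (fun θ => ‖contracted (coc γ A n θ)‖) = fun θ =>
        √(contracted (coc γ A n θ) 0 ^ 2 + contracted (coc γ A n θ) 1 ^ 2) := by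
      funext θ
      rw [← R2.norm_sq, Real.sqrt_sq (norm_nonneg _)]
    rw [this]
    exact ((h0.pow_const 2).add (h1.pow_const 2)).sqrt
  simp only [cSq, contractedDir, PiLp.smul_apply, smul_eq_mul]
  exact (((Complex.measurable_ofReal.comp (hn.inv.mul h0)).add
    ((Complex.measurable_ofReal.comp (hn.inv.mul h1)).mul_const _))).pow_const 2

theorem ae_eventually_ge_log_opNorm_coc [IsProbabilityMeasure m] (hγ : Ergodic γ m)
    (hdet : ∀ θ, (A θ).det = 1) (hA : ∀ i j, Measurable fun θ => A θ i j) {C : ℝ}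
    (hC : ∀ θ, opNorm (A θ) ≤ C) {lam : ℝ}
    (hlam : Tendsto (fun n : ℕ => (∫ θ, Real.log (opNorm (coc γ A n θ)) ∂m) / n) atTop (𝓝 lam))
    {c : ℝ} (hc : c < lam) :
    ∀ᵐ θ ∂m, ∀ᶠ n : ℕ in atTop, n * c ≤ Real.log (opNorm (coc γ A n θ)) :=
  subadditive_ae_eventually_ge hγ (measurable_log_opNorm_coc hγ.measurable hA)
    (abs_log_opNorm_coc_le hdet hC) (log_opNorm_coc_add_le hdet) (log_opNorm_coc_shift hdet hC)
    hlam hc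

theorem ae_eventually_le_log_opNorm_coc [IsProbabilityMeasure m] (hγ : Ergodic γ m)
    (hdet : ∀ θ, (A θ).det = 1) (hA : ∀ i j, Measurable fun θ => A θ i j) {C : ℝ}
    (hC : ∀ θ, opNorm (A θ) ≤ C) {lam : ℝ}
    (hlam : Tendsto (fun n : ℕ => (∫ θ, Real.log (opNorm (coc γ A n θ)) ∂m) / n) atTop (𝓝 lam))
    {c : ℝ} (hc : lam < c) :
    ∀ᵐ θ ∂m, ∀ᶠ n : ℕ in atTop, Real.log (opNorm (coc γ A n θ)) ≤ n * c :=
  subadditive_ae_eventually_le hγ (measurable_log_opNorm_coc hγ.measurable hA)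
    (abs_log_opNorm_coc_le hdet hC) (log_opNorm_coc_add_le hdet) hlam hc

/-- A measurable line field contracted at every exponential rate above `-lam`. -/
theorem exists_contracting_line_field [IsProbabilityMeasure m] (hγ : Ergodic γ m)
    (hdet : ∀ θ, (A θ).det = 1) (hA : ∀ i j, Measurable fun θ => A θ i j) {C : ℝ}
    (hC : ∀ θ, opNorm (A θ) ≤ C) {lam : ℝ} (hpos : 0 < lam)
    (hlam : Tendsto (fun n : ℕ => (∫ θ, Real.log (opNorm (coc γ A n θ)) ∂m) / n) atTop (𝓝 lam)) :
    ∃ α : Θ → ℝ, Measurable α ∧ (∀ θ, α θ ∈ Ico (0 : ℝ) (1 / 2)) ∧ ∀ c, 0 < c → c < lam →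
      ∀ᵐ θ ∂m, ∀ᶠ n : ℕ in atTop,
        ‖mulVecE (coc γ A n θ) (vFull (α θ))‖ ≤ Real.exp (-(n * c)) := by
  obtain ⟨z, hzm, hz⟩ := measurable_limit_of_tendsto_metrizable_ae (μ := m)
    (f := fun n θ => cSq (contractedDir γ A n θ)) (L := atTop)
    (fun n => (measurable_cSq_contractedDir hγ.measurable hA n).aemeasurable) (by
      filter_upwards [ae_eventually_ge_log_opNorm_coc hγ hdet hA hC hlam
        (show lam / 2 < lam by linarith)] with θ hθ
      obtain ⟨l, hl, -⟩ := exists_limit_contractedDir hdet hC (half_pos hpos) hθ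
      exact ⟨l, hl⟩)
  refine ⟨fun θ => lineAngle (z θ), measurable_lineAngle.comp hzm, fun θ => lineAngle_mem _,
    fun c' hc' hcl => ?_⟩
  obtain ⟨ε, hε, hε'⟩ : ∃ ε, 0 < ε ∧ 4 * ε = lam - c' := ⟨(lam - c') / 4, by linarith, by ring⟩
  filter_upwards [hz, ae_eventually_ge_log_opNorm_coc hγ hdet hA hC hlam
    (show lam - ε < lam by linarith), ae_eventually_le_log_opNorm_coc hγ hdet hA hC hlam
    (show lam < lam + ε by linarith)] with θ hzθ hge hle
  obtain ⟨l, hl, hrate⟩ := exists_limit_contractedDir hdet hC (show 0 < lam - ε by linarith) hge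
  obtain rfl : l = z θ := tendsto_nhds_unique hl hzθ
  have hz1 : ‖z θ‖ = 1 := by
    refine tendsto_nhds_unique hzθ.norm (tendsto_const_nhds.congr fun n => ?_)
    rw [norm_cSq, norm_contractedDir hdet, one_pow]
  set v := vFull (lineAngle (z θ)) with hv
  set K := 4 * C ^ 2 / (1 - Real.exp (-(2 * (lam - ε)))) with hK
  have hsmall : Tendsto (fun n : ℕ => (2 + K) * Real.exp (-ε) ^ n) atTop (𝓝 0) := by
    simpa using (tendsto_pow_atTop_nhds_zero_of_lt_one (Real.exp_pos _).le
      (Real.exp_lt_one_iff.2 (by linarith : -ε < 0))).const_mul (2 + K)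
  have hK0 : 0 ≤ K := by
    have : Real.exp (-(2 * (lam - ε))) < 1 := Real.exp_lt_one_iff.2 (by linarith)
    rw [hK]
    exact div_nonneg (by positivity) (by linarith)
  filter_upwards [hge, hle, hrate, hsmall.eventually (gt_mem_nhds zero_lt_one)] with n h1 h2 h3 h4
  have hM := one_le_opNorm (det_coc (γ := γ) hdet n θ)
  have h1' : Real.exp (n * (lam - ε)) ≤ opNorm (coc γ A n θ) :=
    (Real.le_log_iff_exp_le (by linarith)).1 h1
  have h2' : opNorm (coc γ A n θ) ≤ Real.exp (n * (lam + ε)) :=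
    (Real.log_le_iff_le_exp (by linarith)).1 h2
  have hw : |wedge v (contractedDir γ A n θ)| ≤ K * Real.exp (-(n * (2 * (lam - ε)))) := by
    have := norm_cSq_sub (norm_vFull (lineAngle (z θ))) (norm_contractedDir (γ := γ) hdet n θ)
    rw [cSq_vFull_lineAngle hz1, norm_sub_rev, ← dist_eq_norm] at this
    rw [this, ← Real.exp_nat_mul] at h3
    rw [show -(n * (2 * (lam - ε))) = n * -(2 * (lam - ε)) by ring, hK]
    have e : 8 * C ^ 2 * Real.exp (n * -(2 * (lam - ε))) / (1 - Real.exp (-(2 * (lam - ε)))) =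
      2 * (4 * C ^ 2 / (1 - Real.exp (-(2 * (lam - ε)))) * Real.exp (n * -(2 * (lam - ε)))) := by
      ring
    rw [e] at h3
    linarith
  have hn0 : (0 : ℝ) ≤ n := n.cast_nonneg
  calc _ ≤ ‖mulVecE (coc γ A n θ) (contractedDir γ A n θ)‖ +
          |wedge v (contractedDir γ A n θ)| * opNorm (coc γ A n θ) :=
        norm_mulVecE_le_add (norm_vFull _) (norm_contractedDir hdet n θ)
    _ ≤ 2 / Real.exp (n * (lam - ε)) +
          (K * Real.exp (-(n * (2 * (lam - ε))))) * Real.exp (n * (lam + ε)) := by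
        gcongr
        exact (norm_coc_contractedDir_le hdet n θ).trans (by gcongr)
    _ = 2 * Real.exp (-(n * (lam - ε))) + K * Real.exp (-(n * (c' + ε))) := by
        rw [div_eq_mul_inv, ← Real.exp_neg, mul_assoc, ← Real.exp_add]
        congr 3
        linear_combination (n : ℝ) * hε'
    _ ≤ 2 * Real.exp (-(n * (c' + ε))) + K * Real.exp (-(n * (c' + ε))) := by
        gcongr
        linarith
    _ = ((2 + K) * Real.exp (-ε) ^ n) * Real.exp (-(n * c')) := by
        rw [← Real.exp_nat_mul, mul_assoc, ← Real.exp_add,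
          show n * -ε + -(n * c') = -(n * (c' + ε)) by ring]
        ring
    _ ≤ 1 * Real.exp (-(n * c')) := by gcongr
    _ = _ := one_mul _

/-- The stable line field of a determinant-one cocycle with positive exponent. -/
theorem exists_stable_line_field [IsProbabilityMeasure m] (hγ : Ergodic γ m)
    (hdet : ∀ θ, (A θ).det = 1) (hA : ∀ i j, Measurable fun θ => A θ i j) {C : ℝ}
    (hC : ∀ θ, opNorm (A θ) ≤ C) {lam : ℝ} (hpos : 0 < lam)
    (hlam : Tendsto (fun n : ℕ => (∫ θ, Real.log (opNorm (coc γ A n θ)) ∂m) / n) atTop (𝓝 lam)) :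
    ∃ α : Θ → ℝ, Measurable α ∧ (∀ θ, α θ ∈ Ico (0 : ℝ) (1 / 2)) ∧
      (∀ᵐ θ ∂m, ∃ p : ℝ, mulVecE (A θ) (vFull (α θ)) = p • vFull (α (γ θ))) ∧
      ∫ θ, Real.log ‖mulVecE (A θ) (vFull (α θ))‖ ∂m ≤ -lam := by
  obtain ⟨α, hαm, hα, hcon⟩ := exists_contracting_line_field hγ hdet hA hC hpos hlam
  have hinv : ∀ᵐ θ ∂m, ∃ p : ℝ, mulVecE (A θ) (vFull (α θ)) = p • vFull (α (γ θ)) := by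
    have h1 := hcon (lam / 2) (half_pos hpos) (by linarith)
    filter_upwards [h1, hγ.quasiMeasurePreserving.ae h1] with θ hθ hγθ
    refine eq_smul_of_wedge_eq_zero (by rw [← norm_ne_zero_iff, norm_vFull]; exact one_ne_zero) ?_
    have hlim : Tendsto (fun n : ℕ => Real.exp (-((n : ℝ) * (lam / 2)))) atTop (𝓝 0) := by
      refine Real.tendsto_exp_neg_atTop_nhds_zero.comp ?_
      exact tendsto_natCast_atTop_atTop.atTop_mul_const (half_pos hpos)
    have hlim2 := (hlim.comp (tendsto_add_atTop_nat 1)).mul hlim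
    rw [mul_zero] at hlim2
    rw [← abs_eq_zero]
    refine le_antisymm (ge_of_tendsto hlim2 ?_) (abs_nonneg _)
    filter_upwards [(tendsto_add_atTop_nat 1).eventually hθ, hγθ] with n h2 h3
    refine (abs_wedge_le_mul_norm (det_coc (γ := γ) hdet n (γ θ)) _ _).trans ?_
    rw [← mulVecE_mul]
    exact mul_le_mul h2 h3 (norm_nonneg _) (Real.exp_pos _).le
  refine ⟨α, hαm, hα, hinv, ?_⟩
  by_contra! hlt
  have hmeas : Measurable fun θ => Real.log ‖mulVecE (A θ) (vFull (α θ))‖ :=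
    Real.measurable_log.comp (measurable_norm_mulVecE hA (measurable_vFull_coord hαm))
  set I := ∫ θ, Real.log ‖mulVecE (A θ) (vFull (α θ))‖ ∂m
  obtain ⟨c, hc0, hcl, hcI⟩ : ∃ c, 0 < c ∧ c < lam ∧ -c < I :=  by
    obtain ⟨c, hc1, hc2⟩ := exists_between (max_lt hpos (by linarith : -I < lam))
    exact ⟨c, (le_max_left _ _).trans_lt hc1, hc2, by linarith [(le_max_right 0 (-I)).trans_lt hc1]⟩
  obtain ⟨c1, h1, h2⟩ := exists_between hcI
  have hinv' : ∀ᵐ θ ∂m, ∀ k, ∃ p : ℝ,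
      mulVecE (A (γ^[k] θ)) (vFull (α (γ^[k] θ))) = p • vFull (α (γ (γ^[k] θ))) :=
    ae_all_iff.2 fun k => (hγ.toMeasurePreserving.iterate k).quasiMeasurePreserving.ae hinv
  obtain ⟨θ, hθ1, hθ2, hθ3⟩ := (((hcon c hc0 hcl).and ((birkhoffSum_ae_eventually_ge hγ hmeas
    (fun θ => abs_log_norm_mulVecE_le hdet hC (norm_vFull _) θ) h2).and hinv'))).exists
  obtain ⟨n, ⟨h3, h4⟩, h5⟩ := ((hθ1.and hθ2).and (eventually_gt_atTop 0)).exists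
  obtain ⟨P, hP, hP0, hlog⟩ := coc_smul_of_invariant (s := fun θ => vFull (α θ)) hdet
    (fun θ => norm_vFull _) hθ3 n
  rw [hP, norm_smul, norm_vFull, mul_one, Real.norm_eq_abs] at h3
  have h6 := Real.log_le_log (abs_pos.2 hP0) h3
  rw [Real.log_exp, hlog] at h6
  have : (0 : ℝ) < n := by exact_mod_cast h5
  nlinarith

end StableLine

section UnstableLine

variable {Θ : Type*} {A : Θ → Matrix (Fin 2) (Fin 2) ℝ}

theorem coc_symm (γ : Θ ≃ Θ) (n : ℕ) (θ : Θ) :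
    coc γ.symm (fun θ => (A (γ.symm θ))⁻¹) n θ = (coc γ A n (γ.symm^[n] θ))⁻¹ := by
  induction n generalizing θ with
  | zero => simp [coc]
  | succ n ih =>
    rw [coc, ih, coc_succ_left, Matrix.mul_inv_rev, Function.iterate_succ_apply]
    have : γ^[n] (γ.symm^[n] (γ.symm θ)) = γ.symm θ :=
      (Function.LeftInverse.iterate γ.right_inv n) _
    rw [this]

variable [MeasurableSpace Θ] {m : Measure Θ}

theorem ergodic_equiv_symm {γ : Θ ≃ Θ} (hγ : Ergodic γ m) (hγ' : Measurable γ.symm) :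
    Ergodic γ.symm m :=
  Ergodic.symm (e := (⟨γ, hγ.measurable, hγ'⟩ : Θ ≃ᵐ Θ)) hγ

theorem measurable_inv_entry {B : Θ → Matrix (Fin 2) (Fin 2) ℝ} (hdet : ∀ θ, (B θ).det = 1)
    (hB : ∀ i j, Measurable fun θ => B θ i j) (i j : Fin 2) :
    Measurable fun θ => (B θ)⁻¹ i j := by
  simp only [Matrix.inv_def, hdet, Matrix.adjugate_fin_two, Ring.inverse_one, one_smul]
  fin_cases i <;> fin_cases j
  · exact hB 1 1
  · exact (hB 0 1).neg
  · exact (hB 1 0).neg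
  · exact hB 0 0

/-- The unstable line field of a determinant-one cocycle with positive exponent. -/
theorem exists_unstable_line_field [IsProbabilityMeasure m] {γ : Θ ≃ Θ} (hγ : Ergodic γ m)
    (hγ' : Measurable γ.symm) (hdet : ∀ θ, (A θ).det = 1)
    (hA : ∀ i j, Measurable fun θ => A θ i j) {C : ℝ}
    (hC : ∀ θ, opNorm (A θ) ≤ C) {lam : ℝ} (hpos : 0 < lam)
    (hlam : Tendsto (fun n : ℕ => (∫ θ, Real.log (opNorm (coc γ A n θ)) ∂m) / n) atTop (𝓝 lam)) :
    ∃ α : Θ → ℝ, Measurable α ∧ (∀ θ, α θ ∈ Ico (0 : ℝ) (1 / 2)) ∧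
      (∀ᵐ θ ∂m, ∃ p : ℝ, mulVecE (A θ) (vFull (α θ)) = p • vFull (α (γ θ))) ∧
      lam ≤ ∫ θ, Real.log ‖mulVecE (A θ) (vFull (α θ))‖ ∂m := by
  have hs := ergodic_equiv_symm hγ hγ'
  set B : Θ → Matrix (Fin 2) (Fin 2) ℝ := fun θ => (A (γ.symm θ))⁻¹ with hB
  have hBdet : ∀ θ, (B θ).det = 1 := fun θ => det_inv_eq_one (hdet _)
  have hBmeas : ∀ i j, Measurable fun θ => B θ i j := fun i j =>
    (measurable_inv_entry hdet hA i j).comp hγ'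
  have hBC : ∀ θ, opNorm (B θ) ≤ C := fun θ => by
    rw [hB, opNorm_inv (hdet _)]; exact hC _
  have hBlam : Tendsto (fun n : ℕ => (∫ θ, Real.log (opNorm (coc γ.symm B n θ)) ∂m) / n)
      atTop (𝓝 lam) := by
    refine hlam.congr fun n => ?_
    congr 1
    rw [← integral_comp_measurePreserving (hs.toMeasurePreserving.iterate n)
      (measurable_log_opNorm_coc hγ.measurable hA n)]
    refine integral_congr_ae (ae_of_all _ fun θ => ?_)
    simp only [hB, coc_symm, opNorm_inv (det_coc hdet _ _)]
  obtain ⟨α, hαm, hα, hinv, hint⟩ := exists_stable_line_field hs hBdet hBmeas hBC hpos hBlam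
  have key : ∀ᵐ θ ∂m, (∃ p : ℝ, mulVecE (A θ) (vFull (α θ)) = p • vFull (α (γ θ))) ∧
      Real.log ‖mulVecE (A θ) (vFull (α θ))‖ =
        -Real.log ‖mulVecE (B (γ θ)) (vFull (α (γ θ)))‖ := by
    filter_upwards [hγ.quasiMeasurePreserving.ae hinv] with θ hθ
    obtain ⟨p, hp⟩ := hθ
    have hp' := hp
    simp only [hB, Equiv.symm_apply_apply] at hp ⊢
    have h0 : mulVecE (A θ)⁻¹ (vFull (α (γ θ))) ≠ 0 :=
      mulVecE_ne_zero (det_inv_eq_one (hdet θ))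
        (by rw [← norm_ne_zero_iff, norm_vFull]; exact one_ne_zero)
    have hp0 : p ≠ 0 := by
      rintro rfl
      rw [zero_smul] at hp
      exact h0 hp
    have h1 : mulVecE (A θ) (vFull (α θ)) = p⁻¹ • vFull (α (γ θ)) := by
      rw [← mulVecE_mulVecE_inv (hdet θ) (vFull (α (γ θ))), hp, mulVecE_smul, smul_smul,
        inv_mul_cancel₀ hp0, one_smul]
    refine ⟨⟨_, h1⟩, ?_⟩
    rw [h1, hp, norm_smul, norm_smul, norm_vFull, norm_vFull, norm_inv, mul_one, mul_one,
      Real.log_inv]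
  refine ⟨α, hαm, hα, key.mono fun θ h => h.1, ?_⟩
  rw [integral_congr_ae (key.mono fun θ h => h.2), integral_neg,
    integral_comp_measurePreserving (f := fun θ => Real.log ‖mulVecE (B θ) (vFull (α θ))‖)
      hγ.toMeasurePreserving (Real.measurable_log.comp
      (measurable_norm_mulVecE hBmeas (measurable_vFull_coord hαm)))]
  linarith

/-- A full-measure property holds on an invariant measurable set of full measure. -/
theorem exists_invariant_full_set [IsProbabilityMeasure m] {γ : Θ ≃ Θ} (hγ : MeasurePreserving γ m m)
    (hγ' : MeasurePreserving γ.symm m m) {P : Θ → Prop} (hP : ∀ᵐ θ ∂m, P θ) :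
    ∃ Θ₀ : Set Θ, MeasurableSet Θ₀ ∧ γ ⁻¹' Θ₀ = Θ₀ ∧ m Θ₀ = 1 ∧ ∀ θ ∈ Θ₀, P θ := by
  obtain ⟨N, hN, hNm, hN0⟩ := exists_measurable_superset_of_null (ae_iff.1 hP)
  refine ⟨(⋃ k : ℕ, γ^[k] ⁻¹' N ∪ γ.symm^[k] ⁻¹' N)ᶜ, ?_, ?_, ?_, ?_⟩
  · exact (MeasurableSet.iUnion fun k => ((hγ.iterate k).measurable hNm).union
      ((hγ'.iterate k).measurable hNm)).compl
  · ext θ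
    simp only [mem_preimage, mem_compl_iff, mem_iUnion, mem_union, not_iff_not]
    constructor
    · rintro ⟨k, h | h⟩
      · exact ⟨k + 1, Or.inl (by rwa [Function.iterate_succ_apply])⟩
      · rcases k with - | k
        · exact ⟨1, Or.inl h⟩
        · exact ⟨k, Or.inr (by rwa [Function.iterate_succ_apply, γ.symm_apply_apply] at h)⟩
    · rintro ⟨k, h | h⟩
      · rcases k with - | k
        · exact ⟨1, Or.inr (by simpa using h)⟩
        · exact ⟨k, Or.inl (by rwa [Function.iterate_succ_apply] at h)⟩
      · exact ⟨k + 1, Or.inr (by rwa [Function.iterate_succ_apply, γ.symm_apply_apply])⟩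
  · rw [prob_compl_eq_one_iff (MeasurableSet.iUnion fun k => ((hγ.iterate k).measurable hNm).union
      ((hγ'.iterate k).measurable hNm)), measure_iUnion_null_iff]
    intro k
    rw [measure_union_null_iff, (hγ.iterate k).measure_preimage hNm.nullMeasurableSet,
      (hγ'.iterate k).measure_preimage hNm.nullMeasurableSet]
    exact ⟨hN0, hN0⟩
  · intro θ hθ
    by_contra hPθ
    exact hθ (mem_iUnion.2 ⟨0, Or.inl (hN hPθ)⟩)

end UnstableLine

section ConcaveProfile

variable {h : ℝ → ℝ}

theorem GoodH.continuousOn (hh : GoodH h) : ContinuousOn h (Ici 0) := hh.1.continuousOn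

theorem GoodH.pos (hh : GoodH h) {x : ℝ} (hx : 0 < x) : 0 < h x := by
  obtain ⟨-, hmono, -, -, -, h0, -⟩ := hh
  have := hmono (mem_Ici.2 le_rfl) (mem_Ici.2 hx.le) hx
  rwa [h0] at this

theorem GoodH.nonneg (hh : GoodH h) {x : ℝ} (hx : 0 ≤ x) : 0 ≤ h x := hh.2.2.2.2.1 x hx

theorem GoodH.zero (hh : GoodH h) : h 0 = 0 := hh.2.2.2.2.2.1

theorem GoodH.lt (hh : GoodH h) {x y : ℝ} (hx : 0 ≤ x) (hxy : x < y) : h x < h y :=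
  hh.2.1 (mem_Ici.2 hx) (mem_Ici.2 (hx.trans hxy.le)) hxy

theorem GoodH.le (hh : GoodH h) {x y : ℝ} (hx : 0 ≤ x) (hxy : x ≤ y) : h x ≤ h y :=
  hh.2.1.monotoneOn (mem_Ici.2 hx) (mem_Ici.2 (hx.trans hxy)) hxy

theorem GoodH.slope_lt (hh : GoodH h) {x y : ℝ} (hx : 0 < x) (hxy : x < y) :
    h y / y < h x / x := by
  have hy : 0 < y := hx.trans hxy
  have := hh.2.2.1.2 (mem_Ici.2 le_rfl) (mem_Ici.2 hy.le) hy.ne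
    (show 0 < 1 - x / y by rw [sub_pos, div_lt_one hy]; exact hxy) (div_pos hx hy) (by ring)
  simp only [smul_eq_mul, hh.zero, mul_zero, zero_add] at this
  rw [div_mul_cancel₀ _ hy.ne'] at this
  rw [lt_div_iff₀ hx]
  calc h y / y * x = x / y * h y := by ring
    _ < h x := this

theorem GoodH.tendsto_slope (hh : GoodH h) : Tendsto (fun x => h x / x) (𝓝[>] 0) (𝓝 1) := by
  have hd : HasDerivWithinAt h 1 (Ici 0) 0 := by
    have := (hh.1.differentiableOn (by norm_num) 0 (mem_Ici.2 le_rfl)).hasDerivWithinAt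
    rwa [hh.2.2.2.2.2.2] at this
  have := hasDerivWithinAt_iff_tendsto_slope.1 hd
  rw [show Ici (0 : ℝ) \ {0} = Ioi 0 from Set.Ici_sdiff_left] at this
  refine this.congr fun x => ?_
  rw [slope_def_field, hh.zero, sub_zero, sub_zero]

theorem GoodH.slope_lt_one (hh : GoodH h) {x : ℝ} (hx : 0 < x) : h x / x < 1 := by
  have h1 := hh.slope_lt (half_pos hx) (half_lt_self hx)
  refine h1.trans_le (ge_of_tendsto hh.tendsto_slope ?_)
  filter_upwards [Ioo_mem_nhdsGT (half_pos hx)] with y hy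
  exact (hh.slope_lt hy.1 hy.2).le

theorem GoodH.exists_mul_le (hh : GoodH h) {q : ℝ} (hq : q < 1) :
    ∃ x₀ > 0, ∀ x, 0 ≤ x → x ≤ x₀ → q * x ≤ h x := by
  obtain ⟨x₀, hx₀, hx⟩ := (mem_nhdsGT_iff_exists_Ioc_subset).1
    (hh.tendsto_slope.eventually (lt_mem_nhds hq))
  refine ⟨x₀, hx₀, fun x h0 h1 => ?_⟩
  rcases h0.eq_or_lt with rfl | h0
  · rw [hh.zero, mul_zero]
  · exact ((lt_div_iff₀ h0).1 (hx ⟨h0, h1⟩)).le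

theorem GoodH.log_sub_log_lt (hh : GoodH h) {x y : ℝ} (hx : 0 < x) (hxy : x < y) :
    Real.log (h y) - Real.log (h x) < Real.log y - Real.log x := by
  have hy := hx.trans hxy
  have := Real.log_lt_log (div_pos (hh.pos hy) hy) (hh.slope_lt hx hxy)
  rw [Real.log_div (hh.pos hy).ne' hy.ne', Real.log_div (hh.pos hx).ne' hx.ne'] at this
  linarith

theorem GoodH.abs_log_sub_log_lt (hh : GoodH h) {x y : ℝ} (hx : 0 < x) (hy : 0 < y)
    (hxy : x ≠ y) : |Real.log (h y) - Real.log (h x)| < |Real.log y - Real.log x| := by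
  wlog hlt : x < y generalizing x y
  · rw [abs_sub_comm, abs_sub_comm (Real.log y)]
    exact this hy hx hxy.symm (lt_of_le_of_ne (not_lt.1 hlt) hxy.symm)
  have h1 := hh.log_sub_log_lt hx hlt
  have h2 := Real.log_lt_log (hh.pos hx) (hh.lt hx.le hlt)
  have h3 := Real.log_lt_log hx hlt
  rwa [abs_of_pos (by linarith), abs_of_pos (by linarith)]

theorem GoodH.abs_log_sub_log_le (hh : GoodH h) {x y : ℝ} (hx : 0 < x) (hy : 0 < y) :
    |Real.log (h y) - Real.log (h x)| ≤ |Real.log y - Real.log x| := by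
  rcases eq_or_ne x y with rfl | hxy
  · simp
  · exact (hh.abs_log_sub_log_lt hx hy hxy).le

/-- In logarithmic coordinates `h` contracts uniformly away from the diagonal on compacta. -/
theorem GoodH.exists_uniform_gap (hh : GoodH h) {a b p q : ℝ} (ha : 0 < a) (hp : 0 < p) :
    ∃ η > 0, ∀ x y, 0 < y → x ∈ Icc a b → |Real.log y - Real.log x| ∈ Icc p q →
      |Real.log (h y) - Real.log (h x)| + η ≤ |Real.log y - Real.log x| := by
  set S : Set (ℝ × ℝ) := Icc a b ×ˢ {t : ℝ | |t| ∈ Icc p q} with hS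
  have hSc : IsCompact S := by
    refine isCompact_Icc.prod (Metric.isCompact_of_isClosed_isBounded
      (isClosed_Icc.preimage continuous_abs) (isBounded_iff_forall_norm_le.2 ⟨q, fun t ht => ht.2⟩))
  have hlogh : ContinuousOn (fun x => Real.log (h x)) (Ioi 0) :=
    (hh.continuousOn.mono Ioi_subset_Ici_self).log fun x hx => (hh.pos hx).ne'
  have hcont : ContinuousOn (fun z : ℝ × ℝ => |z.2| -
      |Real.log (h (z.1 * Real.exp z.2)) - Real.log (h z.1)|) S := by
    have h1 : ContinuousOn (fun z : ℝ × ℝ => Real.log (h (z.1 * Real.exp z.2))) S :=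
      hlogh.comp (f := fun z : ℝ × ℝ => z.1 * Real.exp z.2) (by fun_prop)
        fun z hz => mul_pos (ha.trans_le hz.1.1) (Real.exp_pos _)
    have h2 : ContinuousOn (fun z : ℝ × ℝ => Real.log (h z.1)) S :=
      hlogh.comp (f := fun z : ℝ × ℝ => z.1) (by fun_prop) fun z hz => ha.trans_le hz.1.1
    exact (continuous_snd.abs.continuousOn).sub ((h1.sub h2).abs)
  have hpos : ∀ z ∈ S, 0 < |z.2| - |Real.log (h (z.1 * Real.exp z.2)) - Real.log (h z.1)| := by
    rintro ⟨x, t⟩ ⟨hx, ht⟩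
    have hx0 : 0 < x := ha.trans_le hx.1
    have ht0 : t ≠ 0 := abs_pos.1 (hp.trans_le ht.1)
    have := hh.abs_log_sub_log_lt hx0 (mul_pos hx0 (Real.exp_pos t)) (by
      intro hxt
      have : Real.exp t = 1 := mul_left_cancel₀ hx0.ne' (by rw [← hxt, mul_one])
      exact ht0 ((Real.exp_eq_one_iff t).1 this))
    rw [Real.log_mul hx0.ne' (Real.exp_pos t).ne', Real.log_exp, add_sub_cancel_left] at this
    exact sub_pos.2 this
  have hmap : ∀ x y, 0 < y → x ∈ Icc a b → |Real.log y - Real.log x| ∈ Icc p q →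
      (x, Real.log y - Real.log x) ∈ S ∧ x * Real.exp (Real.log y - Real.log x) = y := by
    intro x y hy hx hxy
    have hx0 : 0 < x := ha.trans_le hx.1
    exact ⟨⟨hx, hxy⟩, by rw [Real.exp_sub, Real.exp_log hy, Real.exp_log hx0]; field_simp⟩
  rcases S.eq_empty_or_nonempty with hemp | hne
  · refine ⟨1, one_pos, fun x y hy hx hxy => ?_⟩
    have := (hmap x y hy hx hxy).1
    rw [hemp] at this
    exact this.elim
  · obtain ⟨z, hz, hmin⟩ := hSc.exists_isMinOn hne hcont
    refine ⟨_, hpos z hz, fun x y hy hx hxy => ?_⟩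
    obtain ⟨h1, h2⟩ := hmap x y hy hx hxy
    have := isMinOn_iff.1 hmin _ h1
    simp only [h2] at this
    linarith

end ConcaveProfile

section ScalarPullback

variable {Θ : Type*} {γ : Θ ≃ Θ} {h : ℝ → ℝ} {β : ℝ} {ω : Θ → ℝ}

/-- The pullback iterates of the radius `1` under `r ↦ h (β r) ω`. -/
def pullbackRadius (γ : Θ ≃ Θ) (h : ℝ → ℝ) (β : ℝ) (ω : Θ → ℝ) : ℕ → Θ → ℝ
  | 0, _ => 1
  | n + 1, θ => h (β * pullbackRadius γ h β ω n (γ.symm θ)) * ω (γ.symm θ)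

/-- The limit of the pullback iterates. -/
def limitRadius (γ : Θ ≃ Θ) (h : ℝ → ℝ) (β : ℝ) (ω : Θ → ℝ) (θ : Θ) : ℝ :=
  ⨅ n, pullbackRadius γ h β ω n θ

theorem pullbackRadius_pos (hh : GoodH h) (hβ : 0 < β) (hω : ∀ θ, 0 < ω θ) (n : ℕ) (θ : Θ) :
    0 < pullbackRadius γ h β ω n θ := by
  induction n generalizing θ with
  | zero => exact one_pos
  | succ n ih => exact mul_pos (hh.pos (mul_pos hβ (ih _))) (hω _)

theorem pullbackRadius_antitone (hh : GoodH h) (hβ : 0 < β) (hω : ∀ θ, 0 < ω θ)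
    (hone : ∀ θ x, 0 ≤ x → h x * ω θ ≤ 1) (θ : Θ) :
    Antitone fun n => pullbackRadius γ h β ω n θ := by
  refine antitone_nat_of_succ_le fun n => ?_
  induction n generalizing θ with
  | zero => exact hone _ _ (by simpa [pullbackRadius] using hβ.le)
  | succ n ih =>
    refine mul_le_mul_of_nonneg_right (hh.le ?_ ?_) (hω _).le
    · exact (mul_pos hβ (pullbackRadius_pos hh hβ hω _ _)).le
    · exact mul_le_mul_of_nonneg_left (ih _) hβ.le

theorem tendsto_pullbackRadius (hh : GoodH h) (hβ : 0 < β) (hω : ∀ θ, 0 < ω θ)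
    (hone : ∀ θ x, 0 ≤ x → h x * ω θ ≤ 1) (θ : Θ) :
    Tendsto (fun n => pullbackRadius γ h β ω n θ) atTop (𝓝 (limitRadius γ h β ω θ)) :=
  tendsto_atTop_ciInf (pullbackRadius_antitone hh hβ hω hone θ)
    ⟨0, by rintro _ ⟨n, rfl⟩; exact (pullbackRadius_pos hh hβ hω n θ).le⟩

theorem limitRadius_le (hh : GoodH h) (hβ : 0 < β) (hω : ∀ θ, 0 < ω θ)
    (hone : ∀ θ x, 0 ≤ x → h x * ω θ ≤ 1) (n : ℕ) (θ : Θ) :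
    limitRadius γ h β ω θ ≤ pullbackRadius γ h β ω n θ :=
  (pullbackRadius_antitone hh hβ hω hone θ).le_of_tendsto
    (tendsto_pullbackRadius hh hβ hω hone θ) n

theorem limitRadius_nonneg (hh : GoodH h) (hβ : 0 < β) (hω : ∀ θ, 0 < ω θ) (θ : Θ) :
    0 ≤ limitRadius γ h β ω θ :=
  le_ciInf fun n => (pullbackRadius_pos hh hβ hω n θ).le

theorem limitRadius_apply (hh : GoodH h) (hβ : 0 < β) (hω : ∀ θ, 0 < ω θ)
    (hone : ∀ θ x, 0 ≤ x → h x * ω θ ≤ 1) (θ : Θ) :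
    limitRadius γ h β ω (γ θ) = h (β * limitRadius γ h β ω θ) * ω θ := by
  have h1 := (tendsto_add_atTop_iff_nat 1).2
    (tendsto_pullbackRadius hh hβ hω hone (γ := γ) (γ θ))
  simp only [pullbackRadius, Equiv.symm_apply_apply] at h1
  refine tendsto_nhds_unique h1 (Tendsto.mul_const _ ?_)
  have hc := hh.continuousOn (β * limitRadius γ h β ω θ)
    (mul_nonneg hβ.le (limitRadius_nonneg hh hβ hω θ))
  refine hc.tendsto.comp (tendsto_nhdsWithin_iff.2
    ⟨(tendsto_pullbackRadius hh hβ hω hone θ).const_mul β, Eventually.of_forall fun n => ?_⟩)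
  exact (mul_pos hβ (pullbackRadius_pos hh hβ hω n θ)).le

theorem le_limitRadius (hh : GoodH h) (hβ : 0 < β) (hω : ∀ θ, 0 < ω θ) {ρ : Θ → ℝ} {S : Set Θ}
    (hS : ∀ θ ∈ S, γ.symm θ ∈ S) (hρ1 : ∀ θ ∈ S, ρ θ ≤ 1) (hρ0 : ∀ θ ∈ S, 0 ≤ ρ θ)
    (hρ : ∀ θ ∈ S, ρ θ ≤ h (β * ρ (γ.symm θ)) * ω (γ.symm θ)) {θ : Θ} (hθ : θ ∈ S) :
    ρ θ ≤ limitRadius γ h β ω θ := by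
  refine le_ciInf fun n => ?_
  induction n generalizing θ with
  | zero => exact hρ1 θ hθ
  | succ n ih =>
    refine (hρ θ hθ).trans (mul_le_mul_of_nonneg_right (hh.le ?_ ?_) (hω _).le)
    · exact mul_nonneg hβ.le (hρ0 _ (hS θ hθ))
    · exact mul_le_mul_of_nonneg_left (ih (hS θ hθ)) hβ.le

/-- A measurable positive lower bound for the limit radius. -/
theorem exists_pos_le_limitRadius [MeasurableSpace Θ] (hγ' : Measurable γ.symm) (hh : GoodH h)
    {lam : ℝ} (hlam : 0 < lam) (hβ : β = Real.exp lam) (hω : ∀ θ, 0 < ω θ) (hωm : Measurable ω)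
    {S : Set Θ} (hS : ∀ θ ∈ S, γ.symm θ ∈ S) (hbdd : ∀ θ ∈ S, BddBelow (range fun n =>
      birkhoffSum γ.symm (fun θ => Real.log (ω (γ.symm θ))) n θ)) :
    ∃ ρ : Θ → ℝ, Measurable ρ ∧ (∀ θ, 0 < ρ θ) ∧ ∀ θ ∈ S, ρ θ ≤ limitRadius γ h β ω θ := by
  have hβ0 : 0 < β := hβ ▸ Real.exp_pos _
  obtain ⟨x₀, hx₀, hx⟩ := hh.exists_mul_le (Real.exp_lt_one_iff.2 (neg_lt_zero.2 hlam))
  set C₀ := min 1 (x₀ / β)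
  have hC₀ : 0 < C₀ := lt_min one_pos (div_pos hx₀ hβ0)
  set T : Θ → ℝ := fun θ => ⨅ n, birkhoffSum γ.symm (fun θ => Real.log (ω (γ.symm θ))) n θ with hT
  have hTm : Measurable T := Measurable.iInf fun n =>
    measurable_birkhoffSum hγ' (Real.measurable_log.comp (hωm.comp hγ')) n
  have hT0 : ∀ θ ∈ S, T θ ≤ 0 := fun θ hθ => by
    simpa using ciInf_le (hbdd θ hθ) 0
  have hTs : ∀ θ ∈ S, T θ ≤ Real.log (ω (γ.symm θ)) + T (γ.symm θ) := fun θ hθ => by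
    rw [← sub_le_iff_le_add']
    refine le_ciInf fun n => ?_
    rw [sub_le_iff_le_add']
    refine (ciInf_le (hbdd θ hθ) (n + 1)).trans (le_of_eq ?_)
    rw [birkhoffSum_succ']
  have hle : ∀ θ ∈ S, C₀ * Real.exp (T θ) ≤ C₀ := fun θ hθ =>
    mul_le_of_le_one_right hC₀.le (Real.exp_le_one_iff.2 (hT0 θ hθ))
  refine ⟨fun θ => C₀ * Real.exp (T θ), (Real.measurable_exp.comp hTm).const_mul _,
    fun θ => mul_pos hC₀ (Real.exp_pos _), fun θ hθ => ?_⟩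
  refine le_limitRadius (ρ := fun θ => C₀ * Real.exp (T θ)) hh hβ0 hω hS
    (fun θ hθ => (hle θ hθ).trans (min_le_left _ _))
    (fun θ _ => (mul_pos hC₀ (Real.exp_pos _)).le) (fun θ hθ => ?_) hθ
  have h1 : C₀ * Real.exp (T (γ.symm θ)) ≤ h (β * (C₀ * Real.exp (T (γ.symm θ)))) := by
    have h2 : β * (C₀ * Real.exp (T (γ.symm θ))) ≤ x₀ := by
      rw [mul_comm, ← le_div_iff₀ hβ0]
      exact (hle _ (hS θ hθ)).trans (min_le_right _ _)
    have h3 := hx _ (mul_nonneg hβ0.le (mul_pos hC₀ (Real.exp_pos _)).le) h2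
    rwa [← mul_assoc, hβ, ← Real.exp_add, neg_add_cancel, Real.exp_zero, one_mul, ← hβ] at h3
  calc C₀ * Real.exp (T θ) ≤ C₀ * Real.exp (Real.log (ω (γ.symm θ)) + T (γ.symm θ)) := by
        gcongr; exact hTs θ hθ
    _ = C₀ * Real.exp (T (γ.symm θ)) * ω (γ.symm θ) := by
        rw [Real.exp_add, Real.exp_log (hω _)]; ring
    _ ≤ _ := mul_le_mul_of_nonneg_right h1 (hω _).le

end ScalarPullback

section Attractor

theorem not_frequently_jump {V : ℕ → ℝ} (hV : Monotone V) (hb : BddAbove (range V)) {η : ℝ}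
    (hη : 0 < η) : ¬ ∃ᶠ k in atTop, V k + η ≤ V (k + 1) := by
  have h1 := tendsto_atTop_ciSup hV hb
  have h2 := ((tendsto_add_atTop_iff_nat 1).2 h1).sub h1
  rw [sub_self] at h2
  rw [not_frequently]
  filter_upwards [h2.eventually (gt_mem_nhds hη)] with k hk
  linarith

variable {Θ : Type*} {γ : Θ ≃ Θ} {A : Θ → Matrix (Fin 2) (Fin 2) ℝ} {h : ℝ → ℝ} {β : ℝ}

theorem fibMap_eq (θ : Θ) (v : R2) :
    fibMap A h β θ v = (h (β * ‖v‖) / ‖v‖) • mulVecE (A θ) v := by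
  unfold fibMap
  split_ifs with hv
  · rw [hv, mulVecE_zero, smul_zero]
  · rfl

theorem skewProd_iterate_fst (n : ℕ) (p : Θ × R2) :
    ((skewProd γ A h β)^[n] p).1 = γ^[n] p.1 := by
  induction n generalizing p with
  | zero => rfl
  | succ n ih => rw [Function.iterate_succ_apply, ih, Function.iterate_succ_apply]; rfl

theorem GoodH.div_norm_pos (hh : GoodH h) (hβ : 0 < β) {v : R2} (hv : v ≠ 0) :
    0 < h (β * ‖v‖) / ‖v‖ :=
  div_pos (hh.pos (mul_pos hβ (norm_pos_iff.2 hv))) (norm_pos_iff.2 hv)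

theorem fibMap_injective (hdet : ∀ θ, (A θ).det = 1) (hh : GoodH h) (hβ : 0 < β) (θ : Θ) :
    Function.Injective (fibMap A h β θ) := by
  have key : ∀ v : R2, ‖mulVecE (A θ)⁻¹ (fibMap A h β θ v)‖ = h (β * ‖v‖) := fun v => by
    rw [fibMap_eq, mulVecE_smul, mulVecE_inv_mulVecE (hdet θ), norm_smul, Real.norm_eq_abs,
      abs_of_nonneg (div_nonneg (hh.nonneg (mul_nonneg hβ.le (norm_nonneg v))) (norm_nonneg v))]
    rcases eq_or_ne v 0 with rfl | hv
    · simp [hh.zero]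
    · exact div_mul_cancel₀ _ (norm_ne_zero_iff.2 hv)
  intro v w hvw
  have hnorm : ‖v‖ = ‖w‖ := by
    have h1 : h (β * ‖v‖) = h (β * ‖w‖) := by rw [← key v, ← key w, hvw]
    have h2 := hh.2.1.injOn (mem_Ici.2 (mul_nonneg hβ.le (norm_nonneg v)))
      (mem_Ici.2 (mul_nonneg hβ.le (norm_nonneg w))) h1
    exact mul_left_cancel₀ hβ.ne' h2
  rcases eq_or_ne v 0 with rfl | hv
  · rw [norm_zero] at hnorm
    exact (norm_eq_zero.1 hnorm.symm).symm
  · have h1 := congrArg (mulVecE (A θ)⁻¹) hvw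
    rw [fibMap_eq, fibMap_eq, mulVecE_smul, mulVecE_smul, mulVecE_inv_mulVecE (hdet θ),
      mulVecE_inv_mulVecE (hdet θ), ← hnorm] at h1
    exact smul_right_injective _ (hh.div_norm_pos hβ hv).ne' h1

theorem skewProd_injective (hdet : ∀ θ, (A θ).det = 1) (hh : GoodH h) (hβ : 0 < β) :
    Function.Injective (skewProd γ A h β) := by
  rintro ⟨θ, v⟩ ⟨θ', v'⟩ heq
  obtain ⟨h1, h2⟩ := Prod.ext_iff.1 heq
  obtain rfl : θ = θ' := γ.injective h1
  exact Prod.ext rfl (fibMap_injective hdet hh hβ θ h2)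

theorem exists_backward_orbit (hdet : ∀ θ, (A θ).det = 1) (hh : GoodH h) (hβ : 0 < β) {θ : Θ}
    {x : R2} (hx : x ∈ attractorFib γ A h β θ) : ∃ y : ℕ → R2, y 0 = x ∧ (∀ n, ‖y n‖ ≤ 1) ∧
      ∀ n, fibMap A h β (γ.symm^[n + 1] θ) (y (n + 1)) = y n := by
  have h1 : ∀ n, ∃ q : Θ × R2, ‖q.2‖ ≤ 1 ∧ (skewProd γ A h β)^[n] q = (θ, x) := fun n => by
    obtain ⟨q, hq, hqx⟩ := mem_iInter.1 hx n
    exact ⟨q, by simpa using hq.2, hqx⟩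
  choose q hq1 hq using h1
  have hstep : ∀ n, skewProd γ A h β (q (n + 1)) = q n := fun n =>
    (skewProd_injective hdet hh hβ).iterate n (by
      rw [hq n, ← Function.iterate_succ_apply, hq (n + 1)])
  have h0 : q 0 = (θ, x) := hq 0
  have hfst : ∀ n, (q n).1 = γ.symm^[n] θ := fun n => by
    induction n with
    | zero => rw [h0]; rfl
    | succ n ih =>
      rw [Function.iterate_succ_apply', ← ih, ← hstep n, Equiv.eq_symm_apply]
      rfl
  refine ⟨fun n => (q n).2, congrArg Prod.snd h0, hq1, fun n => ?_⟩
  rw [← hfst]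
  exact congrArg Prod.snd (hstep n)

variable {u : Θ → R2}

theorem norm_fibMap_of_wedge_eq_zero (hh : GoodH h) (hβ : 0 < β) (hu : ∀ θ, ‖u θ‖ = 1) {θ : Θ}
    {v : R2} (hv : wedge v (u θ) = 0) :
    ‖fibMap A h β θ v‖ = h (β * ‖v‖) * ‖mulVecE (A θ) (u θ)‖ := by
  obtain ⟨c, hc⟩ := eq_smul_of_wedge_eq_zero (by rw [← norm_ne_zero_iff, hu]; exact one_ne_zero) hv
  have hcn : ‖v‖ = |c| := by rw [hc, norm_smul, hu, mul_one, Real.norm_eq_abs]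
  rw [fibMap_eq, norm_smul, Real.norm_eq_abs,
    abs_of_nonneg (div_nonneg (hh.nonneg (mul_nonneg hβ.le (norm_nonneg v))) (norm_nonneg v)), hcn,
    hc, mulVecE_smul, norm_smul, Real.norm_eq_abs, ← mul_assoc]
  rcases eq_or_ne c 0 with rfl | hc0
  · simp [hh.zero]
  · rw [div_mul_cancel₀ _ (abs_ne_zero.2 hc0)]

theorem wedge_fibMap (hdet : ∀ θ, (A θ).det = 1) {θ : Θ} {p : ℝ}
    (hp : mulVecE (A θ) (u θ) = p • u (γ θ)) (v : R2) :
    p * wedge (fibMap A h β θ v) (u (γ θ)) = h (β * ‖v‖) / ‖v‖ * wedge v (u θ) := by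
  rw [← wedge_smul_right, ← hp, fibMap_eq, wedge_smul_left, wedge_mulVecE, hdet, one_mul]

theorem abs_eq_norm_mulVecE (hu : ∀ θ, ‖u θ‖ = 1) {θ : Θ} {p : ℝ}
    (hp : mulVecE (A θ) (u θ) = p • u (γ θ)) : |p| = ‖mulVecE (A θ) (u θ)‖ := by
  rw [hp, norm_smul, hu, mul_one, Real.norm_eq_abs]

theorem norm_mulVecE_unit_pos (hdet : ∀ θ, (A θ).det = 1) (hu : ∀ θ, ‖u θ‖ = 1) (θ : Θ) :
    0 < ‖mulVecE (A θ) (u θ)‖ :=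
  norm_pos_iff.2 (mulVecE_ne_zero (hdet θ) (by rw [← norm_ne_zero_iff, hu]; exact one_ne_zero))

theorem smul_mem_image (hdet : ∀ θ, (A θ).det = 1) (hh : GoodH h) (hβ : 0 < β)
    (hu : ∀ θ, ‖u θ‖ = 1) {S : Set Θ} (hS : ∀ θ ∈ S, γ.symm θ ∈ S)
    (hinv : ∀ θ ∈ S, ∃ p : ℝ, mulVecE (A θ) (u θ) = p • u (γ θ)) (n : ℕ) {θ : Θ} (hθ : θ ∈ S)
    {s : ℝ} (hs : |s| ≤ pullbackRadius γ h β (fun θ => ‖mulVecE (A θ) (u θ)‖) n θ) :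
    ∃ y : R2, ‖y‖ ≤ 1 ∧ (skewProd γ A h β)^[n] (γ.symm^[n] θ, y) = (θ, s • u θ) := by
  induction n generalizing θ s with
  | zero => exact ⟨s • u θ, by rwa [norm_smul, hu, mul_one, Real.norm_eq_abs], rfl⟩
  | succ n ih =>
    set θ' := γ.symm θ with hθ'
    set G := pullbackRadius γ h β (fun θ => ‖mulVecE (A θ) (u θ)‖) n θ'
    have hG : 0 < G := pullbackRadius_pos hh hβ (norm_mulVecE_unit_pos hdet hu) n θ'
    have hγθ : γ θ' = θ := γ.apply_symm_apply θ
    obtain ⟨p, hp⟩ := hinv θ' (hS θ hθ)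
    obtain ⟨r, hr, hrs⟩ : |s| ∈ (fun r => h (β * r) * ‖mulVecE (A θ') (u θ')‖) '' Icc 0 G := by
      refine intermediate_value_Icc hG.le ?_ ⟨?_, hs⟩
      · exact (hh.continuousOn.comp (f := fun r => β * r) (by fun_prop)
          fun r hr => mul_nonneg hβ.le hr.1).mul continuousOn_const
      · simp [hh.zero]
    obtain ⟨r', hr', hfib⟩ : ∃ r' : ℝ, |r'| ≤ G ∧ fibMap A h β θ' (r' • u θ') = s • u θ := by
      have hco : ∀ r' : ℝ, |r'| = r → ∃ t, |t| = |s| ∧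
          fibMap A h β θ' (r' • u θ') = t • u θ ∧ fibMap A h β θ' (-r' • u θ') = -t • u θ := by
        intro r' hr'
        have hn : ‖r' • u θ'‖ = r := by rw [norm_smul, hu, mul_one, Real.norm_eq_abs, hr']
        have hn' : ‖-r' • u θ'‖ = r := by rw [neg_smul, norm_neg, hn]
        have hfib : fibMap A h β θ' (r' • u θ') = (h (β * r) / r * r' * p) • u θ := by
          rw [fibMap_eq, hn, mulVecE_smul, hp, hγθ, smul_smul, smul_smul]
        refine ⟨_, ?_, hfib, ?_⟩
        · have hN := norm_fibMap_of_wedge_eq_zero (A := A) hh hβ hu (θ := θ') (v := r' • u θ')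
            (by rw [wedge_smul_left, wedge_self, mul_zero])
          rw [hn, hfib, norm_smul, hu, mul_one, Real.norm_eq_abs] at hN
          exact hN.trans hrs
        · rw [fibMap_eq, hn', mulVecE_smul, hp, hγθ, smul_smul, smul_smul]
          congr 1
          ring
      obtain ⟨t, ht, h1, h2⟩ := hco r (abs_of_nonneg hr.1)
      rcases abs_eq_abs.1 ht with rfl | rfl
      · exact ⟨r, by rw [abs_of_nonneg hr.1]; exact hr.2, h1⟩
      · exact ⟨-r, by rw [abs_neg, abs_of_nonneg hr.1]; exact hr.2, by rw [h2, neg_neg]⟩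
    obtain ⟨y, hy, hyn⟩ := ih (hS θ hθ) hr'
    refine ⟨y, hy, ?_⟩
    rw [Function.iterate_succ_apply γ.symm, Function.iterate_succ_apply' (skewProd γ A h β), ← hθ',
      hyn, skewProd, hfib, hγθ]

theorem norm_le_pullbackRadius (hdet : ∀ θ, (A θ).det = 1) (hh : GoodH h) (hβ : 0 < β)
    (hu : ∀ θ, ‖u θ‖ = 1) {S : Set Θ} (hS : ∀ θ ∈ S, γ.symm θ ∈ S)
    (hinv : ∀ θ ∈ S, ∃ p : ℝ, mulVecE (A θ) (u θ) = p • u (γ θ)) (n : ℕ) {θ : Θ} (hθ : θ ∈ S)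
    {y : ℕ → R2} (hy1 : ∀ n, ‖y n‖ ≤ 1)
    (hy : ∀ n, fibMap A h β (γ.symm^[n + 1] θ) (y (n + 1)) = y n) (hw : wedge (y 0) (u θ) = 0) :
    ‖y 0‖ ≤ pullbackRadius γ h β (fun θ => ‖mulVecE (A θ) (u θ)‖) n θ := by
  induction n generalizing θ y with
  | zero => exact hy1 0
  | succ n ih =>
    have hy0 : fibMap A h β (γ.symm θ) (y 1) = y 0 := hy 0
    obtain ⟨p, hp⟩ := hinv _ (hS θ hθ)
    have hw1 : wedge (y 1) (u (γ.symm θ)) = 0 := by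
      rcases eq_or_ne (y 1) 0 with h1 | h1
      · rw [h1]; simp [wedge]
      · have := wedge_fibMap (h := h) (β := β) hdet hp (y 1)
        rw [hy0, γ.apply_symm_apply, hw, mul_zero] at this
        exact (mul_eq_zero.1 this.symm).resolve_left (hh.div_norm_pos hβ h1).ne'
    have h1 := ih (hS θ hθ) (y := fun n => y (n + 1)) (fun n => hy1 _)
      (fun n => by rw [← Function.iterate_succ_apply]; exact hy (n + 1)) hw1
    rw [← hy0, norm_fibMap_of_wedge_eq_zero hh hβ hu hw1]
    refine mul_le_mul_of_nonneg_right (hh.le (mul_nonneg hβ.le (norm_nonneg _)) ?_) (norm_nonneg _)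
    exact mul_le_mul_of_nonneg_left h1 hβ.le

/-- A bounded backward orbit stays on the unstable line. -/
theorem wedge_eq_zero_of_backward_orbit (hdet : ∀ θ, (A θ).det = 1) (hh : GoodH h) {lam : ℝ}
    (hβ : β = Real.exp lam) (hu : ∀ θ, ‖u θ‖ = 1) {θ : Θ}
    (hinv : ∀ n, ∃ p : ℝ, mulVecE (A (γ.symm^[n + 1] θ)) (u (γ.symm^[n + 1] θ)) =
      p • u (γ (γ.symm^[n + 1] θ)))
    (hsum : ¬ Tendsto (fun n => birkhoffSum γ.symm
      (fun θ => Real.log ‖mulVecE (A (γ.symm θ)) (u (γ.symm θ))‖ - lam) n θ) atTop atBot)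
    {y : ℕ → R2} (hy1 : ∀ n, ‖y n‖ ≤ 1)
    (hy : ∀ n, fibMap A h β (γ.symm^[n + 1] θ) (y (n + 1)) = y n) : wedge (y 0) (u θ) = 0 := by
  have hβ0 : 0 < β := hβ ▸ Real.exp_pos _
  by_contra hw0
  set S : ℕ → ℝ := fun n => birkhoffSum γ.symm
      (fun θ => Real.log ‖mulVecE (A (γ.symm θ)) (u (γ.symm θ))‖ - lam) n θ with hS
  set w : ℕ → ℝ := fun n => wedge (y n) (u (γ.symm^[n] θ)) with hw
  have hγ1 : ∀ n, γ (γ.symm^[n + 1] θ) = γ.symm^[n] θ := fun n => by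
    rw [Function.iterate_succ_apply', γ.apply_symm_apply]
  have hrel : ∀ n, ‖mulVecE (A (γ.symm^[n + 1] θ)) (u (γ.symm^[n + 1] θ))‖ * |w n| =
      h (β * ‖y (n + 1)‖) / ‖y (n + 1)‖ * |w (n + 1)| := fun n => by
    obtain ⟨p, hp⟩ := hinv n
    have := congrArg abs (wedge_fibMap (h := h) (β := β) hdet hp (y (n + 1)))
    rw [hy, hγ1, abs_mul, abs_mul, abs_eq_norm_mulVecE hu hp, abs_of_nonneg
      (div_nonneg (hh.nonneg (mul_nonneg hβ0.le (norm_nonneg _))) (norm_nonneg _))] at this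
    exact this
  have hwn : ∀ n, w n ≠ 0 := fun n => by
    induction n with
    | zero => exact hw0
    | succ n ih =>
      intro h0
      have := hrel n
      rw [h0, abs_zero, mul_zero] at this
      exact ih (abs_eq_zero.1 ((mul_eq_zero.1 this).resolve_left
        (norm_mulVecE_unit_pos hdet hu _).ne'))
  have hwle : ∀ n, |w n| ≤ ‖y n‖ := fun n => by
    have := abs_wedge_le (y n) (u (γ.symm^[n] θ))
    rwa [hu, mul_one] at this
  have hypos : ∀ n, 0 < ‖y n‖ := fun n => (abs_pos.2 (hwn n)).trans_le (hwle n)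
  have hstep : ∀ n, Real.log |w (n + 1)| - S (n + 1) = Real.log |w n| - S n -
      Real.log (h (β * ‖y (n + 1)‖) / (β * ‖y (n + 1)‖)) := fun n => by
    have hD : 0 < h (β * ‖y (n + 1)‖) := hh.pos (mul_pos hβ0 (hypos _))
    have h1 := congrArg Real.log (hrel n)
    rw [Real.log_mul (norm_mulVecE_unit_pos hdet hu _).ne' (abs_pos.2 (hwn n)).ne',
      Real.log_mul (div_pos hD (hypos _)).ne' (abs_pos.2 (hwn _)).ne',
      Real.log_div hD.ne' (hypos _).ne'] at h1
    rw [Real.log_div hD.ne' (mul_pos hβ0 (hypos _)).ne', Real.log_mul hβ0.ne' (hypos _).ne']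
    have h2 : Real.log β = lam := by rw [hβ, Real.log_exp]
    simp only [hS, birkhoffSum_succ, ← Function.iterate_succ_apply' (⇑γ.symm)]
    linarith
  have hmono : Monotone fun n => Real.log |w n| - S n := monotone_nat_of_le_succ fun n => by
    have h1 := hh.slope_lt_one (mul_pos hβ0 (hypos (n + 1)))
    have h2 : 0 < h (β * ‖y (n + 1)‖) / (β * ‖y (n + 1)‖) :=
      div_pos (hh.pos (mul_pos hβ0 (hypos _))) (mul_pos hβ0 (hypos _))
    have := Real.log_neg h2 h1
    rw [hstep]
    linarith
  obtain ⟨b, hb⟩ : ∃ b, ∃ᶠ n in atTop, b < S n := by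
    simp only [tendsto_atBot, not_forall, not_eventually, not_le] at hsum
    exact hsum
  have hlog : ∀ n, Real.log |w n| ≤ 0 := fun n =>
    Real.log_nonpos (abs_nonneg _) ((hwle n).trans (hy1 n))
  have hbdd : BddAbove (range fun n => Real.log |w n| - S n) := by
    refine ⟨-b, ?_⟩
    rintro _ ⟨n, rfl⟩
    obtain ⟨k, hk, hkb⟩ := (frequently_atTop.1 hb) n
    have := hmono hk
    have := hlog k
    simp only at *
    linarith
  set r₀ := Real.exp (Real.log |w 0| + b) with hr₀
  have hr₀0 : 0 < β * r₀ := mul_pos hβ0 (Real.exp_pos _)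
  refine not_frequently_jump hmono hbdd (η := -Real.log (h (β * r₀) / (β * r₀)))
    (neg_pos.2 (Real.log_neg (div_pos (hh.pos hr₀0) hr₀0) (hh.slope_lt_one hr₀0))) ?_
  rw [← map_add_atTop_eq_nat 1, frequently_map] at hb
  refine hb.mono fun n hn => ?_
  have h1 : r₀ ≤ ‖y (n + 1)‖ := by
    refine le_trans ?_ (hwle (n + 1))
    rw [hr₀, ← Real.le_log_iff_exp_le (abs_pos.2 (hwn _))]
    have := hmono (Nat.zero_le (n + 1))
    simp only [hS, birkhoffSum_zero] at this hn ⊢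
    linarith
  have h2 : h (β * ‖y (n + 1)‖) / (β * ‖y (n + 1)‖) ≤ h (β * r₀) / (β * r₀) := by
    rcases h1.eq_or_lt with h1 | h1
    · rw [h1]
    · exact (hh.slope_lt hr₀0 (mul_lt_mul_of_pos_left h1 hβ0)).le
  have h3 := Real.log_le_log (div_pos (hh.pos (mul_pos hβ0 (hypos _))) (mul_pos hβ0 (hypos _))) h2
  simp only [hstep]
  linarith

/-- The attractor fibre is the segment of half-length `limitRadius` in the unstable direction. -/
theorem attractorFib_eq_segment (hdet : ∀ θ, (A θ).det = 1) (hh : GoodH h) {lam : ℝ}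
    (hβ : β = Real.exp lam) (hu : ∀ θ, ‖u θ‖ = 1) {S : Set Θ} (hS : ∀ θ ∈ S, γ.symm θ ∈ S)
    (hone : ∀ θ x, 0 ≤ x → h x * ‖mulVecE (A θ) (u θ)‖ ≤ 1)
    (hinv : ∀ θ ∈ S, ∃ p : ℝ, mulVecE (A θ) (u θ) = p • u (γ θ))
    (hsum : ∀ θ ∈ S, ¬ Tendsto (fun n => birkhoffSum γ.symm
      (fun θ => Real.log ‖mulVecE (A (γ.symm θ)) (u (γ.symm θ))‖ - lam) n θ) atTop atBot)
    {θ : Θ} (hθ : θ ∈ S) :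
    attractorFib γ A h β θ = {x : R2 | ∃ s : ℝ,
      |s| ≤ limitRadius γ h β (fun θ => ‖mulVecE (A θ) (u θ)‖) θ ∧ x = s • u θ} := by
  have hβ0 : 0 < β := hβ ▸ Real.exp_pos _
  have hSn : ∀ n, γ.symm^[n] θ ∈ S := fun n => by
    induction n with
    | zero => exact hθ
    | succ n ih => rw [Function.iterate_succ_apply']; exact hS _ ih
  ext x
  constructor
  · intro hx
    obtain ⟨y, hy0, hy1, hy⟩ := exists_backward_orbit hdet hh hβ0 hx
    have hw := wedge_eq_zero_of_backward_orbit hdet hh hβ hu (fun n => hinv _ (hSn (n + 1)))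
      (hsum θ hθ) hy1 hy
    obtain ⟨c, hc⟩ := eq_smul_of_wedge_eq_zero
      (by rw [← norm_ne_zero_iff, hu]; exact one_ne_zero) hw
    refine ⟨c, ?_, by rw [← hy0, hc]⟩
    have hcn : ‖y 0‖ = |c| := by rw [hc, norm_smul, hu, mul_one, Real.norm_eq_abs]
    rw [← hcn]
    exact le_ciInf fun n => norm_le_pullbackRadius hdet hh hβ0 hu hS hinv n hθ hy1 hy hw
  · rintro ⟨s, hs, rfl⟩
    refine mem_iInter.2 fun n => ?_
    obtain ⟨y, hy, hyn⟩ := smul_mem_image hdet hh hβ0 hu hS hinv n hθ (hs.trans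
      (limitRadius_le hh hβ0 (norm_mulVecE_unit_pos hdet hu) hone n θ))
    exact ⟨_, ⟨mem_univ _, by simpa using hy⟩, hyn⟩

end Attractor

section ForwardConvergence

/-- Two orbits of `r ↦ h (β r) ω` with summable logarithmic errors are logarithmically asymptotic
as soon as one of them recurs to a compact part of `(0, ∞)`. -/
theorem tendsto_log_sub_log {h : ℝ → ℝ} {β : ℝ} (hh : GoodH h) (hβ : 0 < β) {r c ε : ℕ → ℝ}
    (hr : ∀ n, 0 < r n) (hc : ∀ n, 0 < c n) (hc1 : ∀ n, c n ≤ 1) (hε0 : ∀ n, 0 ≤ ε n)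
    (hε : Summable ε)
    (hstep : ∀ n, |(Real.log (r (n + 1)) - Real.log (c (n + 1))) -
      (Real.log (h (β * r n)) - Real.log (h (β * c n)))| ≤ ε n)
    {δ : ℝ} (hδ : 0 < δ) (hfreq : ∃ᶠ n in atTop, δ ≤ c n) :
    Tendsto (fun n => Real.log (r n) - Real.log (c n)) atTop (𝓝 0) := by
  set q : ℕ → ℝ := fun n => |Real.log (r n) - Real.log (c n)| with hq
  set S : ℕ → ℝ := fun n => ∑ k ∈ Finset.range n, ε k with hS
  have hlog : ∀ n, Real.log (β * r n) - Real.log (β * c n) =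
      Real.log (r n) - Real.log (c n) := fun n => by
    rw [Real.log_mul hβ.ne' (hr n).ne', Real.log_mul hβ.ne' (hc n).ne']
    ring
  have hq1 : ∀ n, q (n + 1) ≤ |Real.log (h (β * r n)) - Real.log (h (β * c n))| + ε n := fun n => by
    have h1 := abs_add_le (Real.log (h (β * r n)) - Real.log (h (β * c n)))
      ((Real.log (r (n + 1)) - Real.log (c (n + 1))) -
      (Real.log (h (β * r n)) - Real.log (h (β * c n))))
    rw [add_sub_cancel] at h1
    exact h1.trans (by linarith [hstep n])
  have hmono : Monotone fun n => S n - q n := monotone_nat_of_le_succ fun n => by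
    have h1 := hh.abs_log_sub_log_le (mul_pos hβ (hc n)) (mul_pos hβ (hr n))
    rw [hlog] at h1
    have h2 := hq1 n
    have h3 : S (n + 1) = S n + ε n := Finset.sum_range_succ _ _
    have h4 : q n = |Real.log (r n) - Real.log (c n)| := rfl
    linarith
  have hbdd : BddAbove (range fun n => S n - q n) := by
    refine ⟨∑' k, ε k, ?_⟩
    rintro _ ⟨n, rfl⟩
    have h1 : S n ≤ ∑' k, ε k := hε.sum_le_tsum _ fun k _ => hε0 k
    have h2 : 0 ≤ q n := abs_nonneg _
    simp only
    linarith
  obtain ⟨L, hL⟩ : ∃ L, Tendsto q atTop (𝓝 L) := by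
    refine ⟨_, (hε.hasSum.tendsto_sum_nat.sub (tendsto_atTop_ciSup hmono hbdd)).congr fun n => ?_⟩
    simp only [hS]
    ring
  have hL0 : 0 ≤ L := ge_of_tendsto' hL fun n => abs_nonneg _
  rcases hL0.eq_or_lt with rfl | hL0
  · exact (tendsto_zero_iff_abs_tendsto_zero _).2 hL
  exfalso
  obtain ⟨η, hη, hgap⟩ := hh.exists_uniform_gap (a := β * δ) (b := β) (p := L / 2) (q := 2 * L)
    (mul_pos hβ hδ) (half_pos hL0)
  refine not_frequently_jump hmono hbdd hη ?_
  refine (hfreq.and_eventually (hL.eventually (Icc_mem_nhds (half_lt_self hL0)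
    (show L < 2 * L by linarith)))).mono fun n hn => ?_
  have h1 := hgap (β * c n) (β * r n) (mul_pos hβ (hr n))
    ⟨mul_le_mul_of_nonneg_left hn.1 hβ.le, by nlinarith [hc1 n]⟩ (by rw [hlog]; exact hn.2)
  rw [hlog] at h1
  have h2 := hq1 n
  have h3 : S (n + 1) = S n + ε n := Finset.sum_range_succ _ _
  have h4 : q n = |Real.log (r n) - Real.log (c n)| := rfl
  linarith

theorem tendsto_sub_of_tendsto_log_sub_log {r c : ℕ → ℝ} (hr : ∀ n, 0 < r n) (hc : ∀ n, 0 < c n)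
    (hc1 : ∀ n, c n ≤ 1)
    (hlog : Tendsto (fun n => Real.log (r n) - Real.log (c n)) atTop (𝓝 0)) :
    Tendsto (fun n => r n - c n) atTop (𝓝 0) := by
  have h1 : Tendsto (fun n => |Real.exp (Real.log (r n) - Real.log (c n)) - 1|) atTop (𝓝 0) := by
    have := ((Real.continuous_exp.tendsto 0).comp hlog).sub_const 1
    rw [Real.exp_zero, sub_self] at this
    exact (tendsto_zero_iff_abs_tendsto_zero _).1 this
  refine squeeze_zero_norm (fun n => ?_) h1
  rw [Real.exp_sub, Real.exp_log (hr n), Real.exp_log (hc n), div_sub_one (hc n).ne', abs_div,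
    abs_of_pos (hc n), Real.norm_eq_abs]
  exact le_div_self (abs_nonneg _) (hc n) (hc1 n)

theorem norm_sub_le_or_norm_add_le {v w : R2} (hv : ‖v‖ = 1) (hw : ‖w‖ = 1) :
    ‖v - w‖ ≤ 2 * |wedge v w| ∨ ‖v + w‖ ≤ 2 * |wedge v w| := by
  have h1 := R2.norm_sq v
  have h2 := R2.norm_sq w
  rw [hv] at h1
  rw [hw] at h2
  set d := v 0 * w 0 + v 1 * w 1 with hd
  have hdw : d ^ 2 + wedge v w ^ 2 = 1 := by
    rw [hd, wedge]
    linear_combination (-1 : ℝ) * h1 - (v 0 ^ 2 + v 1 ^ 2) * h2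
  have h3 : ‖v - w‖ ^ 2 = 2 - 2 * d := by
    rw [R2.norm_sq, hd]
    simp only [PiLp.sub_apply]
    linear_combination (-1 : ℝ) * h1 - h2
  have h4 : ‖v + w‖ ^ 2 = 2 + 2 * d := by
    rw [R2.norm_sq, hd]
    simp only [PiLp.add_apply]
    linear_combination (-1 : ℝ) * h1 - h2
  have hd1 : |d| ≤ 1 := by
    rw [← sq_le_one_iff_abs_le_one]
    nlinarith [sq_nonneg (wedge v w)]
  obtain ⟨hd2, hd3⟩ := abs_le.1 hd1
  rcases le_total 0 d with h0 | h0
  · left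
    rw [← sq_le_sq₀ (norm_nonneg _) (by positivity), mul_pow, sq_abs, h3]
    nlinarith
  · right
    rw [← sq_le_sq₀ (norm_nonneg _) (by positivity), mul_pow, sq_abs, h4]
    nlinarith

theorem infDist_pair_le {v w : R2} (hv : ‖v‖ = 1) (hw : ‖w‖ = 1) {r c : ℝ} (hc : 0 ≤ c) :
    infDist (r • v) ({c • w, -(c • w)} : Set R2) ≤ |r - c| + c * (2 * |wedge v w|) := by
  rcases norm_sub_le_or_norm_add_le hv hw with h1 | h1
  · refine (infDist_le_dist_of_mem (mem_insert _ _)).trans ?_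
    rw [dist_eq_norm, show r • v - c • w = (r - c) • v + c • (v - w) by module]
    refine (norm_add_le _ _).trans ?_
    rw [norm_smul, norm_smul, hv, mul_one, Real.norm_eq_abs, Real.norm_eq_abs, abs_of_nonneg hc]
    gcongr
  · refine (infDist_le_dist_of_mem (mem_insert_of_mem _ (mem_singleton _))).trans ?_
    rw [dist_eq_norm, show r • v - -(c • w) = (r - c) • v + c • (v + w) by module]
    refine (norm_add_le _ _).trans ?_
    rw [norm_smul, norm_smul, hv, mul_one, Real.norm_eq_abs, Real.norm_eq_abs, abs_of_nonneg hc]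
    gcongr

theorem log_norm_mulVecE_sub_le {M : Matrix (Fin 2) (Fin 2) ℝ} (hM : M.det = 1) {C : ℝ}
    (hC : opNorm M ≤ C) {v w : R2} (hv : ‖v‖ = 1) (hw : ‖w‖ = 1) :
    Real.log ‖mulVecE M v‖ - Real.log ‖mulVecE M w‖ ≤ C ^ 2 * |wedge v w| := by
  have hC1 := (one_le_opNorm hM).trans hC
  have hne : ∀ v : R2, ‖v‖ = 1 → 0 < ‖mulVecE M v‖ := fun v hv =>
    norm_pos_iff.2 (mulVecE_ne_zero hM (by rw [← norm_ne_zero_iff, hv]; exact one_ne_zero))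
  have h1 := norm_mulVecE_le_add (M := M) hv hw
  have h2 : 1 ≤ C * ‖mulVecE M w‖ := by
    have := norm_le_opNorm_mul hM w
    rw [hw] at this
    exact this.trans (mul_le_mul_of_nonneg_right hC (norm_nonneg _))
  have h3 : |wedge v w| * opNorm M ≤ C ^ 2 * |wedge v w| * ‖mulVecE M w‖ := by
    have h4 : |wedge v w| * opNorm M ≤ |wedge v w| * C :=
      mul_le_mul_of_nonneg_left hC (abs_nonneg _)
    have h5 : |wedge v w| * C * 1 ≤ |wedge v w| * C * (C * ‖mulVecE M w‖) :=
      mul_le_mul_of_nonneg_left h2 (by positivity)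
    linarith
  rw [← Real.log_div (hne v hv).ne' (hne w hw).ne']
  refine (Real.log_le_sub_one_of_pos (div_pos (hne v hv) (hne w hw))).trans ?_
  rw [sub_le_iff_le_add, div_le_iff₀ (hne w hw)]
  linarith

theorem abs_log_norm_mulVecE_sub_le {M : Matrix (Fin 2) (Fin 2) ℝ} (hM : M.det = 1) {C : ℝ}
    (hC : opNorm M ≤ C) {v w : R2} (hv : ‖v‖ = 1) (hw : ‖w‖ = 1) :
    |Real.log ‖mulVecE M v‖ - Real.log ‖mulVecE M w‖| ≤ C ^ 2 * |wedge v w| := by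
  refine abs_sub_le_iff.2 ⟨log_norm_mulVecE_sub_le hM hC hv hw, ?_⟩
  have := log_norm_mulVecE_sub_le hM hC hw hv
  rwa [show wedge w v = -wedge v w by simp [wedge]; ring, abs_neg] at this

variable {Θ : Type*} {γ : Θ ≃ Θ} {A : Θ → Matrix (Fin 2) (Fin 2) ℝ} {h : ℝ → ℝ} {β : ℝ}

theorem skewProd_iterate_succ_snd (n : ℕ) (θ : Θ) (v : R2) :
    ((skewProd γ A h β)^[n + 1] (θ, v)).2 =
      fibMap A h β (γ^[n] θ) ((skewProd γ A h β)^[n] (θ, v)).2 := by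
  rw [Function.iterate_succ_apply', skewProd, skewProd_iterate_fst]

theorem skewProd_iterate_snd_eq_smul (hdet : ∀ θ, (A θ).det = 1) (hh : GoodH h) (hβ : 0 < β)
    (θ : Θ) {v : R2} (hv : v ≠ 0) (n : ℕ) :
    ∃ E : ℝ, 0 < E ∧ ((skewProd γ A h β)^[n] (θ, v)).2 = E • mulVecE (coc γ A n θ) v := by
  induction n with
  | zero => exact ⟨1, one_pos, by simp [coc, mulVecE_one]⟩
  | succ n ih =>
    obtain ⟨E, hE, hEn⟩ := ih
    have hne : E • mulVecE (coc γ A n θ) v ≠ 0 :=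
      smul_ne_zero hE.ne' (mulVecE_ne_zero (det_coc hdet n θ) hv)
    refine ⟨_, mul_pos (hh.div_norm_pos hβ hne) hE, ?_⟩
    rw [skewProd_iterate_succ_snd, hEn, fibMap_eq, mulVecE_smul, smul_smul, coc_succ_left,
      mulVecE_mul]

/-- Forward orbits off the stable line converge to the two end points of the attractor fibres. -/
theorem tendsto_infDist_forward (hdet : ∀ θ, (A θ).det = 1) {C : ℝ} (hC : ∀ θ, opNorm (A θ) ≤ C)
    (hh : GoodH h) (hβ : 0 < β) {u : Θ → R2} (hu : ∀ θ, ‖u θ‖ = 1) {c : Θ → ℝ} {θ : Θ}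
    (hinv : ∀ k, ∃ p : ℝ, mulVecE (A (γ^[k] θ)) (u (γ^[k] θ)) = p • u (γ (γ^[k] θ)))
    (hc : ∀ k, 0 < c (γ^[k] θ)) (hc1 : ∀ k, c (γ^[k] θ) ≤ 1)
    (hcγ : ∀ θ, c (γ θ) = h (β * c θ) * ‖mulVecE (A θ) (u θ)‖)
    {δ : ℝ} (hδ : 0 < δ) (hfreq : ∃ᶠ k in atTop, δ ≤ c (γ^[k] θ)) {κ : ℝ} (hκ : 0 < κ)
    (hgrow : ∀ᶠ n : ℕ in atTop,
      n * κ ≤ birkhoffSum γ (fun θ => Real.log ‖mulVecE (A θ) (u θ)‖) n θ)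
    {s : R2} (hs : ∀ᶠ n : ℕ in atTop, ‖mulVecE (coc γ A n θ) s‖ ≤ Real.exp (-(n * κ)))
    {v : R2} (hvs : wedge v s ≠ 0) :
    Tendsto (fun n : ℕ => infDist ((skewProd γ A h β)^[n] (θ, v)).2
      ({c (γ^[n] θ) • u (γ^[n] θ), -(c (γ^[n] θ) • u (γ^[n] θ))} : Set R2)) atTop (𝓝 0) := by
  have hv : v ≠ 0 := by
    rintro rfl
    exact hvs (by simp [wedge])
  set a : ℕ → R2 := fun n => mulVecE (coc γ A n θ) v with ha
  have hapos : ∀ n, 0 < ‖a n‖ := fun n => norm_pos_iff.2 (mulVecE_ne_zero (det_coc hdet n θ) hv)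
  set d : ℕ → R2 := fun n => ‖a n‖⁻¹ • a n with hd
  have hd1 : ∀ n, ‖d n‖ = 1 := fun n => by
    rw [hd, norm_smul, norm_inv, norm_norm, inv_mul_cancel₀ (hapos n).ne']
  set x : ℕ → R2 := fun n => ((skewProd γ A h β)^[n] (θ, v)).2 with hx
  have hxd : ∀ n, x n ≠ 0 ∧ x n = ‖x n‖ • d n := fun n => by
    obtain ⟨E, hE, hEn⟩ := skewProd_iterate_snd_eq_smul (γ := γ) hdet hh hβ θ hv n
    have hxn : x n = E • a n := hEn
    refine ⟨?_, ?_⟩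
    · rw [hxn]
      exact smul_ne_zero hE.ne' (norm_pos_iff.1 (hapos n))
    · rw [hxn, norm_smul, Real.norm_eq_abs, abs_of_pos hE, hd, smul_smul, mul_assoc,
        mul_inv_cancel₀ (hapos n).ne', mul_one]
  have hr : ∀ n, 0 < ‖x n‖ := fun n => norm_pos_iff.2 (hxd n).1
  set W : ℕ → ℝ := fun n => |wedge (d n) (u (γ^[n] θ))| with hW
  set K : ℝ := |wedge v (u θ)| / |wedge v s| with hK
  have hWK : ∀ᶠ n : ℕ in atTop, W n ≤ K * Real.exp (-(2 * κ)) ^ n := by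
    filter_upwards [hgrow, hs] with n hn hsn
    obtain ⟨P, hP, hP0, hPlog⟩ := coc_smul_of_invariant hdet hu hinv n
    have h1 : |P| * (W n * ‖a n‖) = |wedge v (u θ)| := by
      have h2 := wedge_mulVecE (coc γ A n θ) v (u θ)
      rw [det_coc hdet, one_mul, hP, wedge_smul_right] at h2
      rw [← h2, abs_mul]
      simp only [hW, hd, wedge_smul_left, abs_mul, abs_inv, abs_norm]
      field_simp [(hapos n).ne']
      rfl
    have h2 : |wedge v s| ≤ ‖a n‖ * Real.exp (-(n * κ)) :=
      (abs_wedge_le_mul_norm (det_coc hdet n θ) v s).trans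
        (mul_le_mul_of_nonneg_left hsn (norm_nonneg _))
    have h3 : Real.exp (n * κ) ≤ |P| := by
      rw [← Real.le_log_iff_exp_le (abs_pos.2 hP0), hPlog]
      exact hn
    have h4 : W n * |wedge v s| ≤ |wedge v (u θ)| * Real.exp (-(2 * κ)) ^ n := by
      have hW0 : 0 ≤ W n := abs_nonneg _
      have he : Real.exp (-(2 * κ)) ^ n = Real.exp (-(n * κ)) * Real.exp (-(n * κ)) := by
        rw [← Real.exp_nat_mul, ← Real.exp_add]
        ring_nf
      have he1 : Real.exp (n * κ) * Real.exp (-(n * κ)) = 1 := by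
        rw [← Real.exp_add, add_neg_cancel, Real.exp_zero]
      rw [he]
      have hepos := Real.exp_pos (-(n * κ))
      calc W n * |wedge v s| ≤ W n * (‖a n‖ * Real.exp (-(n * κ))) :=
            mul_le_mul_of_nonneg_left h2 hW0
        _ = Real.exp (n * κ) * (W n * ‖a n‖) * (Real.exp (-(n * κ)) * Real.exp (-(n * κ))) := by
            linear_combination (-(W n * ‖a n‖ * Real.exp (-(n * κ)))) * he1
        _ ≤ |P| * (W n * ‖a n‖) * (Real.exp (-(n * κ)) * Real.exp (-(n * κ))) := by
            gcongr
        _ = _ := by rw [h1]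
    rw [hK, div_mul_eq_mul_div, le_div_iff₀ (abs_pos.2 hvs)]
    exact h4
  have hWsum : Summable W := by
    refine Summable.of_norm_bounded_eventually_nat ((summable_geometric_of_lt_one
      (Real.exp_pos _).le (Real.exp_lt_one_iff.2 (by linarith : -(2 * κ) < 0))).mul_left K) ?_
    filter_upwards [hWK] with n hn
    rwa [Real.norm_eq_abs, abs_abs]
  have hrstep : ∀ n, ‖x (n + 1)‖ = h (β * ‖x n‖) * ‖mulVecE (A (γ^[n] θ)) (d n)‖ := fun n => by
    simp only [hx]
    rw [skewProd_iterate_succ_snd, fibMap_eq]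
    change ‖(h (β * ‖x n‖) / ‖x n‖) • mulVecE (A (γ^[n] θ)) (x n)‖ = _
    rw [norm_smul, Real.norm_eq_abs, abs_of_pos (hh.div_norm_pos hβ (hxd n).1)]
    conv_lhs => rw [show mulVecE (A (γ^[n] θ)) (x n) = ‖x n‖ • mulVecE (A (γ^[n] θ)) (d n) by
      rw [← mulVecE_smul, ← (hxd n).2]]
    rw [norm_smul, norm_norm, ← mul_assoc, div_mul_cancel₀ _ (hr n).ne']
  have hlog := tendsto_log_sub_log hh hβ hr hc hc1 (ε := fun n => C ^ 2 * W n)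
    (fun n => mul_nonneg (sq_nonneg C) (abs_nonneg _)) (hWsum.mul_left _) (fun n => by
      rw [Function.iterate_succ_apply', hcγ, hrstep]
      have hdn : 0 < ‖mulVecE (A (γ^[n] θ)) (d n)‖ := norm_pos_iff.2 (mulVecE_ne_zero (hdet _)
        (by rw [← norm_ne_zero_iff, hd1]; exact one_ne_zero))
      rw [Real.log_mul (hh.pos (mul_pos hβ (hr n))).ne' hdn.ne',
        Real.log_mul (hh.pos (mul_pos hβ (hc n))).ne' (norm_mulVecE_unit_pos hdet hu _).ne']
      refine le_of_eq_of_le (congrArg abs ?_)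
        (abs_log_norm_mulVecE_sub_le (hdet (γ^[n] θ)) (hC _) (hd1 n) (hu _))
      ring) hδ hfreq
  have hsub := tendsto_sub_of_tendsto_log_sub_log hr hc hc1 hlog
  refine squeeze_zero (fun n => infDist_nonneg) (fun n => ?_)
    (g := fun n => |‖x n‖ - c (γ^[n] θ)| + 2 * W n) ?_
  · change infDist (x n) _ ≤ _
    rw [(hxd n).2]
    refine (infDist_pair_le (hd1 n) (hu _) (hc n).le).trans ?_
    rw [← (hxd n).2]
    have hW0 : 0 ≤ 2 * W n := mul_nonneg two_pos.le (abs_nonneg _)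
    exact add_le_add le_rfl (mul_le_of_le_one_left hW0 (hc1 n))
  · simpa using ((tendsto_zero_iff_abs_tendsto_zero _).1 hsub).add
      (hWsum.tendsto_atTop_zero.const_mul 2)

end ForwardConvergence

theorem exists_pos_measure_ge {Θ : Type*} [MeasurableSpace Θ] {m : Measure Θ}
    [IsProbabilityMeasure m] {ρ : Θ → ℝ} (hρ : ∀ θ, 0 < ρ θ) : ∃ δ > 0, m {θ | δ ≤ ρ θ} ≠ 0 := by
  have h1 : (⋃ n : ℕ, {θ | 1 / ((n : ℝ) + 1) ≤ ρ θ}) = univ := eq_univ_of_forall fun θ => by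
    obtain ⟨n, hn⟩ := exists_nat_one_div_lt (hρ θ)
    exact mem_iUnion.2 ⟨n, hn.le⟩
  obtain ⟨n, hn⟩ := exists_measure_pos_of_not_measure_iUnion_null (μ := m)
    (s := fun n : ℕ => {θ | 1 / ((n : ℝ) + 1) ≤ ρ θ}) (by rw [h1, measure_univ]; exact one_ne_zero)
  exact ⟨_, Nat.one_div_pos_of_nat, hn.ne'⟩

/-- If `β₁^m < β = β₂^m` (i.e. `λ_m(A) > 0` and `β = e^{λ_m(A)}`), the
conclusion of the intermediate parameter regime holds without modification. -/
theorem stmt8 {Θ : Type*} [MeasurableSpace Θ]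
    (γ : Θ ≃ Θ) (hγ : Measurable ⇑γ) (hγ' : Measurable ⇑γ.symm)
    (m : Measure Θ) [IsProbabilityMeasure m] (herg : Ergodic ⇑γ m)
    (A : Θ → Matrix (Fin 2) (Fin 2) ℝ) (hdet : ∀ θ, (A θ).det = 1)
    (hAmeas : ∀ i j, Measurable fun θ => A θ i j)
    (hAbdd : ∃ C : ℝ, ∀ θ, opNorm (A θ) ≤ C)
    (h : ℝ → ℝ) (hh : GoodH h) (hscale : Scaled A h)
    (lam : ℝ)
    (hlam : Filter.Tendsto
      (fun n : ℕ => (∫ θ, Real.log (opNorm (coc ⇑γ A n θ)) ∂m) / n)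
      Filter.atTop (𝓝 lam))
    (hpos : 0 < lam) (β : ℝ) (hβ : β = Real.exp lam) :
    ∃ Θ₀ : Set Θ, MeasurableSet Θ₀ ∧ ⇑γ ⁻¹' Θ₀ = Θ₀ ∧ m Θ₀ = 1 ∧
      ∃ αu αs : Θ → ℝ, Measurable αu ∧ Measurable αs ∧
        (∀ θ ∈ Θ₀, αu θ ∈ Set.Ico (0 : ℝ) (1 / 2) ∧ αs θ ∈ Set.Ico (0 : ℝ) (1 / 2)) ∧
        ∃ c : Θ → ℝ, ∀ θ ∈ Θ₀,
          0 < c θ ∧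
          attractorFib ⇑γ A h β θ =
            {x : R2 | ∃ s : ℝ, |s| ≤ c θ ∧ x = s • vFull (αu θ)} ∧
          ∀ v : R2, (¬ ∃ t : ℝ, v = t • vFull (αs θ)) →
            Filter.Tendsto (fun n : ℕ =>
                Metric.infDist ((skewProd ⇑γ A h β)^[n] (θ, v)).2
                  ({c ((⇑γ)^[n] θ) • vFull (αu ((⇑γ)^[n] θ)),
                    -(c ((⇑γ)^[n] θ) • vFull (αu ((⇑γ)^[n] θ)))} : Set R2))
              Filter.atTop (𝓝 0) := by
  have : Nonempty Θ := m.nonempty_of_neZero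
  have hs := ergodic_equiv_symm herg hγ'
  have hβ0 : 0 < β := hβ ▸ Real.exp_pos _
  obtain ⟨C, hC⟩ : ∃ C, C = ⨆ θ : Θ, opNorm (A θ) := ⟨_, rfl⟩
  have hAC : ∀ θ, opNorm (A θ) ≤ C := fun θ => by
    obtain ⟨C', hC'⟩ := hAbdd
    rw [hC]
    exact le_ciSup (f := fun θ => opNorm (A θ)) ⟨C', by rintro _ ⟨θ, rfl⟩; exact hC' θ⟩ θ
  have hC0 : 0 < C := one_pos.trans_le (one_le_of_opNorm_le hdet hAC (Classical.arbitrary Θ))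
  obtain ⟨αu, hαum, hαu, hinv, hmean⟩ :=
    exists_unstable_line_field herg hγ' hdet hAmeas hAC hpos hlam
  obtain ⟨αs, hαsm, hαs, hcon⟩ := exists_contracting_line_field herg hdet hAmeas hAC hpos hlam
  set u : Θ → R2 := fun θ => vFull (αu θ) with hu
  have hu1 : ∀ θ, ‖u θ‖ = 1 := fun θ => norm_vFull _
  set ω : Θ → ℝ := fun θ => ‖mulVecE (A θ) (u θ)‖ with hω
  have hω0 : ∀ θ, 0 < ω θ := norm_mulVecE_unit_pos hdet hu1
  have hωm : Measurable ω := measurable_norm_mulVecE hAmeas (measurable_vFull_coord hαum)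
  have hlogm : Measurable fun θ => Real.log (ω θ) := Real.measurable_log.comp hωm
  have hlogC : ∀ θ, |Real.log (ω θ)| ≤ Real.log C := fun θ =>
    abs_log_norm_mulVecE_le hdet hAC (hu1 θ) θ
  have hone : ∀ θ x, 0 ≤ x → h x * ω θ ≤ 1 := fun θ x hx => by
    have h1 := hscale x hx
    rw [← hC] at h1
    have h2 : ω θ ≤ C := by
      have := norm_mulVecE_le (A θ) (u θ)
      rw [hu1, mul_one] at this
      exact this.trans (hAC θ)
    calc h x * ω θ ≤ C⁻¹ * C := mul_le_mul h1 h2 (hω0 θ).le (inv_nonneg.2 hC0.le)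
      _ = 1 := inv_mul_cancel₀ hC0.ne'
  have hlogm' : Measurable fun θ => Real.log (ω (γ.symm θ)) := hlogm.comp hγ'
  have hmean' : lam ≤ ∫ θ, Real.log (ω (γ.symm θ)) ∂m := by
    rw [integral_comp_measurePreserving hs.toMeasurePreserving hlogm]
    exact hmean
  have hsum : ∀ᵐ θ ∂m, ¬ Tendsto (fun n => birkhoffSum γ.symm
      (fun θ => Real.log (ω (γ.symm θ)) - lam) n θ) atTop atBot := by
    refine ae_not_tendsto_birkhoffSum_atBot hs (hlogm'.sub_const lam)
      (L := Real.log C + |lam|) (fun θ => (abs_sub _ _).trans (by gcongr; exact hlogC _)) ?_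
    rw [integral_sub (integrable_of_abs_le hlogm' fun θ => hlogC _)
      (integrable_const _)]
    simpa using hmean'
  have hbdd : ∀ᵐ θ ∂m, BddBelow (range fun n =>
      birkhoffSum γ.symm (fun θ => Real.log (ω (γ.symm θ))) n θ) := by
    filter_upwards [birkhoffSum_ae_eventually_ge hs hlogm' (fun θ => hlogC _)
      (hpos.trans_le hmean')] with θ hθ
    refine IsBoundedUnder.bddBelow_range ⟨0, eventually_map.2 (hθ.mono fun n hn => ?_)⟩
    simpa using hn
  have hgrow : ∀ᵐ θ ∂m, ∀ᶠ n : ℕ in atTop,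
      n * (lam / 2) ≤ birkhoffSum γ (fun θ => Real.log (ω θ)) n θ :=
    birkhoffSum_ae_eventually_ge herg hlogm hlogC ((half_lt_self hpos).trans_le hmean)
  obtain ⟨Θ₁, hΘ₁m, hΘ₁, hΘ₁1, hP₁⟩ := exists_invariant_full_set herg.toMeasurePreserving
    hs.toMeasurePreserving (hbdd.and (hinv.and (hsum.and
      (hgrow.and (hcon (lam / 2) (half_pos hpos) (half_lt_self hpos))))))
  have hΘ₁ae : ∀ᵐ θ ∂m, θ ∈ Θ₁ := (mem_ae_iff_prob_eq_one hΘ₁m).2 hΘ₁1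
  have hΘ₁s : ∀ θ ∈ Θ₁, γ.symm θ ∈ Θ₁ := fun θ hθ => by
    rw [← hΘ₁, mem_preimage, γ.apply_symm_apply]
    exact hθ
  have hΘ₁γ : ∀ θ ∈ Θ₁, γ θ ∈ Θ₁ := fun θ hθ => by
    rw [← hΘ₁] at hθ
    exact hθ
  obtain ⟨ρ, hρm, hρ0, hρ⟩ := exists_pos_le_limitRadius hγ' hh hpos hβ hω0 hωm hΘ₁s
    fun θ hθ => (hP₁ θ hθ).1
  obtain ⟨δ, hδ, hδm⟩ := exists_pos_measure_ge (m := m) hρ0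
  obtain ⟨Θ₂, hΘ₂m, hΘ₂, hΘ₂1, hP₂⟩ := exists_invariant_full_set herg.toMeasurePreserving
    hs.toMeasurePreserving ((ae_frequently_iterate_mem herg
      (measurableSet_le measurable_const hρm) hδm).and hΘ₁ae)
  have hit : ∀ θ ∈ Θ₁, ∀ n, γ^[n] θ ∈ Θ₁ := fun θ hθ n => by
    induction n with
    | zero => exact hθ
    | succ n ih => rw [Function.iterate_succ_apply']; exact hΘ₁γ _ ih
  have hpos' : ∀ θ ∈ Θ₁, 0 < limitRadius γ h β ω θ := fun θ hθ => (hρ0 θ).trans_le (hρ θ hθ)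
  refine ⟨Θ₂, hΘ₂m, hΘ₂, hΘ₂1, αu, αs, hαum, hαsm, fun θ _ => ⟨hαu θ, hαs θ⟩,
    limitRadius γ h β ω, fun θ hθ => ?_⟩
  obtain ⟨hfreq, hθ₁⟩ := hP₂ θ hθ
  obtain ⟨-, -, -, hgrowθ, hconθ⟩ := hP₁ θ hθ₁
  refine ⟨hpos' θ hθ₁, attractorFib_eq_segment hdet hh hβ hu1 hΘ₁s hone
    (fun θ hθ => (hP₁ θ hθ).2.1) (fun θ hθ => (hP₁ θ hθ).2.2.1) hθ₁, fun v hv => ?_⟩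
  refine tendsto_infDist_forward hdet hAC hh hβ0 hu1 (fun k => (hP₁ _ (hit θ hθ₁ k)).2.1)
    (fun k => hpos' _ (hit θ hθ₁ k)) (fun k => limitRadius_le hh hβ0 hω0 hone 0 _)
    (limitRadius_apply hh hβ0 hω0 hone) hδ
    (hfreq.mono fun k hk => le_trans hk (hρ _ (hit θ hθ₁ k))) (half_pos hpos) hgrowθ hconθ
    fun hw => hv (eq_smul_of_wedge_eq_zero ?_ hw)
  rw [← norm_ne_zero_iff, norm_vFull]
  exact one_ne_zero
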